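/- arXiv:2409.06922 — 2 statements merged into one kernel-verified Lean document; each statement's English description precedes it below -/
import Mathlib

section
/- Let κ > 1 and c > 0, and let (λ_n)_{n≥1} be a sequence of positive real numbers satisfying λ_n = c n^κ (1 + o(1)) as n → ∞. Then, for z tending to infinity in any closed sector {z : θ₁ ≤ arg z ≤ θ₂} with 0 < θ₁ ≤ θ₂ < 2π (so the sector does not meet the nonnegative real axis), one has ∑_{n=1}^∞ (λ_n − z)^{-1} = (2πi / ((1 − e^{2πi/κ}) κ c^{1/κ})) · z^{1/κ − 1} + o(|z|^{1/κ − 1}), uniformly in the sector. -/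
open Filter

/-- The argument of a nonzero complex number chosen in `(0, 2π]`
(branch cut along the positive real axis, limit from the upper half-plane). -/
noncomputable def branchArg (z : ℂ) : ℝ :=
  if Complex.arg z ≤ 0 then Complex.arg z + 2 * Real.pi else Complex.arg z

/-- The power `z^α` defined via the branch of the logarithm with branch cut on the
positive real axis: `z^α = exp(α (ln|z| + i arg z))` with `arg z ∈ (0, 2π)`. -/
noncomputable def branchCpow (z : ℂ) (α : ℝ) : ℂ :=
  Complex.exp ((α : ℂ) * ((Real.log ‖z‖ : ℂ) + (branchArg z : ℂ) * Complex.I))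

section Aux

open MeasureTheory Set

lemma aux_real (κ c w : ℝ) (hκ : 1 < κ) (hc : 0 < c) (hw : 0 < w) :
    IntegrableOn (fun x : ℝ => (c * x ^ κ + w)⁻¹) (Ioi 0) ∧
    ∫ x in Ioi (0:ℝ), (c * x ^ κ + w)⁻¹ =
      w ^ (1 / κ - 1) * (c ^ (-1 / κ) * (Real.pi / (κ * Real.sin (Real.pi / κ)))) := by
  have hκ0 : 0 < κ := by linarith
  have hinv : 1 / κ < 1 := by rw [div_lt_one hκ0]; exact hκ
  have hinv0 : 0 < 1 / κ := by positivity
  let f : ℝ → ℝ → ℝ := fun x t => Real.exp (-(c * x ^ κ + w) * t)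
  -- integral in t
  have h1 : ∀ x ∈ Ioi (0:ℝ), ∫ t in Ioi (0:ℝ), f x t = (c * x ^ κ + w)⁻¹ := by
    intro x hx
    have hx' : 0 < x := hx
    have hp : 0 < c * x ^ κ + w := by positivity
    have := integral_exp_mul_Ioi (a := -(c * x ^ κ + w)) (by linarith) 0
    simp only [f]
    rw [this]
    rw [neg_div_neg_eq]; simp
  -- integral in x
  have h2 : ∀ t ∈ Ioi (0:ℝ), ∫ x in Ioi (0:ℝ), f x t =
      (c ^ (-1 / κ) * Real.Gamma (1 / κ + 1)) * (t ^ ((1 - 1 / κ) - 1) * Real.exp (-(w * t))) := by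
    intro t ht
    have ht' : 0 < t := ht
    have e : ∀ x, f x t = Real.exp (-(w*t)) * Real.exp (-(c * t) * x ^ κ) := by
      intro x; simp only [f]; rw [← Real.exp_add]; congr 1; ring
    simp_rw [e]
    rw [integral_const_mul, integral_exp_neg_mul_rpow hκ0 (by positivity),
      Real.mul_rpow hc.le ht'.le]
    have : (1 - 1 / κ) - 1 = -1 / κ := by ring
    rw [this]; ring
  have hint_t : IntegrableOn (fun t : ℝ => t ^ ((1 - 1 / κ) - 1) * Real.exp (-(w * t))) (Ioi 0) := by
    have := integrableOn_rpow_mul_exp_neg_mul_rpow (p := 1) (s := (1 - 1 / κ) - 1) (b := w)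
      (by linarith) one_pos hw
    simpa using this
  have hprod : Integrable (Function.uncurry f)
      ((volume.restrict (Ioi (0:ℝ))).prod (volume.restrict (Ioi (0:ℝ)))) := by
    rw [integrable_prod_iff']
    · constructor
      · refine (ae_restrict_iff' measurableSet_Ioi).2 (Filter.Eventually.of_forall fun t ht => ?_)
        have ht' : 0 < t := ht
        have e : ∀ x, f x t = Real.exp (-(w*t)) * Real.exp (-(c * t) * x ^ κ) := by
          intro x; simp only [f]; rw [← Real.exp_add]; congr 1; ring
        simp only [Function.uncurry, e]
        have := integrableOn_rpow_mul_exp_neg_mul_rpow (p := κ) (s := 0) (b := c * t)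
          (by linarith) hκ0 (by positivity)
        simp only [Real.rpow_zero, one_mul] at this
        exact this.const_mul _
      · have : IntegrableOn (fun t => ∫ x in Ioi (0:ℝ), f x t) (Ioi 0) :=
          IntegrableOn.congr_fun (hint_t.const_mul _) (fun t ht => (h2 t ht).symm) measurableSet_Ioi
        have e : ∀ x t, ‖f x t‖ = f x t := fun x t => by
          simp only [f, Real.norm_eq_abs, Real.abs_exp]
        simp only [Function.uncurry, e]
        exact this
    · apply Measurable.aestronglyMeasurable
      simp only [Function.uncurry_def, f]
      fun_prop
  constructor
  · have := hprod.integral_prod_left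
    exact IntegrableOn.congr_fun (f := fun x => ∫ t in Ioi (0:ℝ), f x t) this h1 measurableSet_Ioi
  · rw [← setIntegral_congr_fun measurableSet_Ioi h1, integral_integral_swap hprod,
      setIntegral_congr_fun measurableSet_Ioi h2, integral_const_mul,
      Real.integral_rpow_mul_exp_neg_mul_Ioi (by linarith) hw]
    have hg : Real.Gamma (1 / κ + 1) * Real.Gamma (1 - 1 / κ) =
        Real.pi / (κ * Real.sin (Real.pi / κ)) := by
      rw [Real.Gamma_add_one hinv0.ne', mul_assoc, Real.Gamma_mul_Gamma_one_sub]
      rw [mul_one_div, one_div_mul_eq_div, div_div, mul_comm κ]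
    rw [← hg, one_div w, Real.inv_rpow hw.le, ← Real.rpow_neg hw.le]
    have : -(1 - 1/κ) = 1/κ - 1 := by ring
    rw [this]; ring

/-- Lower bound away from the cut. -/
lemma aux_lower (a b t : ℝ) (hb : |b| ≤ Real.pi) :
    Real.cos (b / 2) * (t + Real.exp a) ≤ ‖(t : ℂ) + Complex.exp (a + b * Complex.I)‖ := by
  have hc : 0 ≤ Real.cos (b/2) := by
    rw [abs_le] at hb
    apply Real.cos_nonneg_of_mem_Icc; constructor <;> linarith
  have he := Real.exp_pos a
  apply le_of_sq_le_sq _ (norm_nonneg _) |> fun h => h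
  rw [← Complex.normSq_eq_norm_sq, Complex.normSq_apply]
  have h1 : ((t : ℂ) + Complex.exp (a + b * Complex.I)).re = t + Real.exp a * Real.cos b := by
    simp [Complex.exp_re]
  have h2 : ((t : ℂ) + Complex.exp (a + b * Complex.I)).im = Real.exp a * Real.sin b := by
    simp [Complex.exp_im]
  rw [h1, h2]
  have h3 : Real.cos b = 2 * Real.cos (b/2)^2 - 1 := by rw [← Real.cos_two_mul]; congr 1; ring
  have h4 := Real.sin_sq_add_cos_sq b
  have h5 := Real.sin_sq_add_cos_sq (b/2)
  have : (t + Real.exp a * Real.cos b) * (t + Real.exp a * Real.cos b) + Real.exp a * Real.sin b * (Real.exp a * Real.sin b)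
     - (Real.cos (b / 2) * (t + Real.exp a))^2 = (1 - Real.cos (b/2)^2) * (t - Real.exp a)^2 := by
    have : Real.sin b * Real.sin b = 1 - Real.cos b * Real.cos b := by linarith
    linear_combination (2 * t * Real.exp a) * h3 + Real.exp a ^2 * this
  have : 0 ≤ (1 - Real.cos (b/2)^2) * (t - Real.exp a)^2 := by
    apply mul_nonneg _ (sq_nonneg _); nlinarith [sq_nonneg (Real.sin (b/2))]
  linarith

lemma aux_floor (f : ℕ → ℂ) (hf : IntegrableOn (fun t : ℝ => f ⌊t⌋₊) (Ioi 0)) :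
    ∑' n, f n = ∫ t in Ioi (0:ℝ), f ⌊t⌋₊ := by
  have hU : (⋃ n : ℕ, Ico (n:ℝ) (n+1)) = Ici 0 := by
    ext x; simp only [mem_iUnion, mem_Ico, mem_Ici]
    constructor
    · rintro ⟨n, h, -⟩; exact le_trans (Nat.cast_nonneg n) h
    · intro h; exact ⟨⌊x⌋₊, Nat.floor_le h, Nat.lt_floor_add_one x⟩
  have hd : Pairwise (Function.onFun Disjoint fun n : ℕ => Ico (n:ℝ) (n+1)) := by
    intro m n hmn
    rw [Function.onFun, Set.disjoint_left]
    intro x hx hy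
    apply hmn
    rw [← (Nat.floor_eq_iff (le_trans (Nat.cast_nonneg m) hx.1)).2 hx,
       ← (Nat.floor_eq_iff (le_trans (Nat.cast_nonneg m) hx.1)).2 hy]
  have := hasSum_integral_iUnion (f := fun t : ℝ => f ⌊t⌋₊) (μ := volume)
    (fun n : ℕ => measurableSet_Ico) hd (by rw [hU, integrableOn_Ici_iff_integrableOn_Ioi]; exact hf)
  rw [hU, integral_Ici_eq_integral_Ioi] at this
  rw [← this.tsum_eq]
  congr 1; ext n
  rw [setIntegral_congr_fun (g := fun _ => f n) measurableSet_Ico]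
  · simp
  · intro x hx
    simp only
    rw [(Nat.floor_eq_iff (le_trans (Nat.cast_nonneg n) hx.1)).2 hx]

lemma aux_cos_le (B b : ℝ) (hB : B ≤ Real.pi) (hb : |b| ≤ B) :
    Real.cos (B / 2) ≤ Real.cos (b / 2) := by
  rw [← Real.cos_abs (b / 2)]
  apply Real.cos_le_cos_of_nonneg_of_le_pi (abs_nonneg _)
  · linarith [abs_nonneg b, Real.pi_pos]
  · rw [abs_div, abs_of_pos (two_pos : (0:ℝ) < 2)]; linarith

lemma aux_meas (κ c : ℝ) (s : ℂ) :
    Measurable (fun x : ℝ => (((c * x ^ κ : ℝ) : ℂ) + Complex.exp s)⁻¹) := by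
  fun_prop

lemma aux_deriv (κ c : ℝ) (hκ : 1 < κ) (hc : 0 < c) (s₀ : ℂ) (hs : |s₀.im| < Real.pi) :
    IntegrableOn (fun x : ℝ => (((c * x ^ κ : ℝ) : ℂ) + Complex.exp s₀)⁻¹) (Ioi 0) ∧
    DifferentiableAt ℂ (fun s : ℂ => ∫ x in Ioi (0:ℝ), (((c * x ^ κ : ℝ) : ℂ) + Complex.exp s)⁻¹) s₀ := by
  set ρ := (Real.pi - |s₀.im|) / 2 with hρ
  have hρ0 : 0 < ρ := by rw [hρ]; linarith
  set δ := Real.cos ((Real.pi - ρ) / 2) with hδ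
  have hδ0 : 0 < δ := by
    apply Real.cos_pos_of_mem_Ioo
    have := abs_nonneg s₀.im
    constructor <;> linarith
  set m := Real.exp (s₀.re - ρ) with hm
  set M := Real.exp (s₀.re + ρ) with hM
  have hm0 : 0 < m := Real.exp_pos _
  have hM0 : 0 < M := Real.exp_pos _
  have key : ∀ s ∈ Metric.ball s₀ ρ, ∀ x ∈ Ioi (0:ℝ),
      δ * (c * x ^ κ + m) ≤ ‖((c * x ^ κ : ℝ) : ℂ) + Complex.exp s‖ := by
    intro s hsb x hx
    have hx' : 0 < x := hx
    have hy : 0 < c * x ^ κ := by positivity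
    rw [mem_ball_iff_norm] at hsb
    have him := (Complex.abs_im_le_norm (s - s₀)).trans hsb.le
    have hre := (Complex.abs_re_le_norm (s - s₀)).trans hsb.le
    rw [Complex.sub_im] at him
    rw [Complex.sub_re] at hre
    have hb : |s.im| ≤ Real.pi - ρ := by
      have := abs_sub_abs_le_abs_sub s.im s₀.im
      linarith
    have h1 := aux_lower s.re s.im (c * x ^ κ) (by linarith)
    rw [Complex.re_add_im] at h1
    refine le_trans ?_ h1
    have h2 : m ≤ Real.exp s.re := Real.exp_le_exp.2 (by rw [abs_le] at hre; linarith)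
    have h3 := aux_cos_le (Real.pi - ρ) s.im (by linarith) hb
    apply mul_le_mul h3 (by linarith) (by positivity) (by linarith)
  have hi := (aux_real κ c m hκ hc hm0).1
  have hint : IntegrableOn (fun x : ℝ => (((c * x ^ κ : ℝ) : ℂ) + Complex.exp s₀)⁻¹) (Ioi 0) := by
    refine Integrable.mono' (hi.const_mul δ⁻¹) (aux_meas κ c s₀).aestronglyMeasurable ?_
    refine (ae_restrict_iff' measurableSet_Ioi).2 (Filter.Eventually.of_forall fun x hx => ?_)
    have hx' : 0 < x := hx
    have hp : 0 < c * x ^ κ + m := by positivity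
    rw [norm_inv, ← mul_inv]
    exact inv_anti₀ (by positivity) (key s₀ (Metric.mem_ball_self hρ0) x hx)
  refine ⟨hint, ?_⟩
  have := hasDerivAt_integral_of_dominated_loc_of_deriv_le (μ := volume.restrict (Ioi (0:ℝ)))
    (F := fun (s : ℂ) (x : ℝ) => (((c * x ^ κ : ℝ) : ℂ) + Complex.exp s)⁻¹)
    (F' := fun (s : ℂ) (x : ℝ) => -Complex.exp s / (((c * x ^ κ : ℝ) : ℂ) + Complex.exp s) ^ 2)
    (x₀ := s₀) (bound := fun x => (M / (δ ^ 2 * m)) * (c * x ^ κ + m)⁻¹)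
    (Metric.ball_mem_nhds s₀ hρ0)
    (Filter.Eventually.of_forall fun s => (aux_meas κ c s).aestronglyMeasurable) hint
    (Measurable.aestronglyMeasurable (by fun_prop)) ?_ (hi.const_mul _) ?_
  · exact this.2.differentiableAt
  · refine (ae_restrict_iff' measurableSet_Ioi).2 (Filter.Eventually.of_forall fun x hx => ?_)
    intro s hsb
    have hx' : 0 < x := hx
    have hy : 0 < c * x ^ κ := by positivity
    have hk := key s hsb x hx
    rw [mem_ball_iff_norm] at hsb
    have hre := (Complex.abs_re_le_norm (s - s₀)).trans hsb.le
    rw [Complex.sub_re, abs_le] at hre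
    have hn : ‖Complex.exp s‖ ≤ M := by
      rw [Complex.norm_exp]; exact Real.exp_le_exp.2 (by linarith)
    rw [norm_div, norm_neg, norm_pow]
    calc _ ≤ M / (δ * (c * x ^ κ + m)) ^ 2 := by gcongr
      _ = (M / (δ ^ 2 * (c * x ^ κ + m))) * (c * x ^ κ + m)⁻¹ := by
        field_simp
      _ ≤ _ := by gcongr; linarith
  · refine (ae_restrict_iff' measurableSet_Ioi).2 (Filter.Eventually.of_forall fun x hx => ?_)
    intro s hsb
    have hx' : 0 < x := hx
    have hk := key s hsb x hx
    have hne : ((c * x ^ κ : ℝ) : ℂ) + Complex.exp s ≠ 0 := by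
      rw [← norm_pos_iff]
      exact lt_of_lt_of_le (by positivity) hk
    exact ((Complex.hasDerivAt_exp s).const_add _).inv hne

lemma aux_strip (κ c : ℝ) (hκ : 1 < κ) (hc : 0 < c) (s : ℂ) (hs : |s.im| < Real.pi) :
    ∫ x in Ioi (0:ℝ), (((c * x ^ κ : ℝ) : ℂ) + Complex.exp s)⁻¹ =
      Complex.exp (((1 / κ - 1 : ℝ) : ℂ) * s) *
        ((c ^ (-1 / κ) * (Real.pi / (κ * Real.sin (Real.pi / κ))) : ℝ) : ℂ) := by
  let U : Set ℂ := {s | |s.im| < Real.pi}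
  have hUo : IsOpen U := isOpen_lt (by fun_prop) continuous_const
  have hUc : IsPreconnected U := by
    have : U = Complex.imLm ⁻¹' (Ioo (-Real.pi) Real.pi) := by
      ext x; simp [U, abs_lt]
    rw [this]
    exact ((convex_Ioo _ _).linear_preimage _).isPreconnected
  have hA := DifferentiableOn.analyticOnNhd (s := U) (fun s hs =>
    (aux_deriv κ c hκ hc s hs).2.differentiableWithinAt) hUo
  have hB := DifferentiableOn.analyticOnNhd (s := U) (f := fun s : ℂ =>
     Complex.exp (((1 / κ - 1 : ℝ) : ℂ) * s) *
        ((c ^ (-1 / κ) * (Real.pi / (κ * Real.sin (Real.pi / κ))) : ℝ) : ℂ))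
    (by fun_prop) hUo
  refine hA.eqOn_of_preconnected_of_frequently_eq hB hUc (z₀ := 0) (by simp [U, Real.pi_pos]) ?_ hs
  have hreal : ∀ a : ℝ, ∫ x in Ioi (0:ℝ), (((c * x ^ κ : ℝ) : ℂ) + Complex.exp a)⁻¹ =
      Complex.exp (((1 / κ - 1 : ℝ) : ℂ) * a) *
        ((c ^ (-1 / κ) * (Real.pi / (κ * Real.sin (Real.pi / κ))) : ℝ) : ℂ) := by
    intro a
    have h := (aux_real κ c (Real.exp a) hκ hc (Real.exp_pos a)).2
    rw [← Real.exp_mul, mul_comm a] at h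
    have h' := congrArg (fun x : ℝ => (x : ℂ)) h
    simp only [← integral_complex_ofReal] at h'
    push_cast at h' ⊢
    exact h'
  have ht : Filter.Tendsto (fun n : ℕ => (((1 / ((n:ℝ) + 1) : ℝ)) : ℂ)) atTop (nhdsWithin 0 {0}ᶜ) := by
    rw [tendsto_nhdsWithin_iff]
    constructor
    · have := (Complex.continuous_ofReal.tendsto 0).comp (tendsto_one_div_add_atTop_nhds_zero_nat (𝕜 := ℝ))
      exact this
    · refine Filter.Eventually.of_forall fun n => ?_
      have : (1 / ((n:ℝ) + 1)) ≠ 0 := by positivity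
      simpa only [mem_compl_iff, mem_singleton_iff, Complex.ofReal_eq_zero] using this
  exact ht.frequently (Filter.Frequently.of_forall fun n => hreal _)

lemma aux_E (κ c : ℝ) (hκ : 1 < κ) (hc : 0 < c)
    (lam : ℕ → ℝ) (a : ℝ) (ha : 0 < a) (hlow : ∀ n : ℕ, a * ((n:ℝ) + 1) ^ κ ≤ lam (n + 1))
    (hasym : Tendsto (fun n : ℕ => lam n / (c * (n : ℝ) ^ κ)) atTop (nhds 1)) :
    Tendsto (fun N : ℝ => ∫ x in Ioi (0:ℝ),
      |(lam (⌊x * N⌋₊ + 1) / N ^ κ + 1)⁻¹ - (c * x ^ κ + 1)⁻¹|) atTop (nhds 0) := by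
  have hκ0 : 0 < κ := by linarith
  have h0 : (0:ℝ) = ∫ x in Ioi (0:ℝ), (0:ℝ) := by simp
  suffices H : Tendsto (fun N : ℝ => ∫ x in Ioi (0:ℝ),
      |(lam (⌊x * N⌋₊ + 1) / N ^ κ + 1)⁻¹ - (c * x ^ κ + 1)⁻¹|) atTop
      (nhds (∫ x in Ioi (0:ℝ), (0:ℝ))) by rwa [← h0] at H
  apply tendsto_integral_filter_of_dominated_convergence
    (fun x => (a * x ^ κ + 1)⁻¹ + (c * x ^ κ + 1)⁻¹)
  · refine Filter.Eventually.of_forall fun N => Measurable.aestronglyMeasurable ?_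
    have : Measurable (fun x : ℝ => lam (⌊x * N⌋₊ + 1)) :=
      (measurable_from_top (f := fun n : ℕ => lam (n + 1))).comp (by fun_prop)
    fun_prop
  · filter_upwards [Filter.eventually_gt_atTop 0] with N hN
    refine (ae_restrict_iff' measurableSet_Ioi).2 (Filter.Eventually.of_forall fun x hx => ?_)
    have hx' : 0 < x := hx
    have h1 : a * x ^ κ ≤ lam (⌊x * N⌋₊ + 1) / N ^ κ := by
      rw [le_div_iff₀ (by positivity), mul_assoc, ← Real.mul_rpow hx'.le hN.le]
      refine le_trans ?_ (hlow _)
      gcongr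
      exact (Nat.lt_floor_add_one _).le
    have h2 : 0 < a * x ^ κ := by positivity
    rw [Real.norm_eq_abs, abs_abs]
    refine (abs_sub _ _).trans ?_
    rw [abs_of_nonneg (by positivity : 0 ≤ (c * x ^ κ + 1)⁻¹), abs_of_nonneg (by
      apply inv_nonneg.2; linarith)]
    gcongr
  · exact (aux_real κ a 1 hκ ha one_pos).1.add (aux_real κ c 1 hκ hc one_pos).1
  · refine (ae_restrict_iff' measurableSet_Ioi).2 (Filter.Eventually.of_forall fun x hx => ?_)
    have hx' : 0 < x := hx
    have hfl : Tendsto (fun N : ℝ => ⌊x * N⌋₊ + 1) atTop atTop :=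
      Filter.tendsto_add_atTop_nat 1 |>.comp (tendsto_nat_floor_atTop.comp
        (Filter.tendsto_id.const_mul_atTop hx'))
    have h1 := hasym.comp hfl
    have h2 : Tendsto (fun N : ℝ => ((⌊x * N⌋₊ + 1 : ℕ) : ℝ) / N) atTop (nhds x) := by
      have := (tendsto_nat_floor_mul_div_atTop (R := ℝ) hx'.le).add
        (tendsto_inv_atTop_zero (𝕜 := ℝ))
      rw [add_zero] at this
      refine this.congr fun N => ?_
      push_cast; ring
    have h3 := h2.rpow_const (p := κ) (Or.inl hx'.ne')
    have h4 : Tendsto (fun N : ℝ => lam (⌊x * N⌋₊ + 1) / N ^ κ) atTop (nhds (c * x ^ κ)) := by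
      have := (h1.const_mul c).mul h3
      rw [mul_one] at this
      refine this.congr' ?_
      filter_upwards [Filter.eventually_gt_atTop 0] with N hN
      simp only [Function.comp]
      rw [Real.div_rpow (by positivity) hN.le]
      have : 0 < ((⌊x * N⌋₊ + 1 : ℕ) : ℝ) ^ κ := by positivity
      field_simp
    have h5 := ((h4.add_const 1).inv₀ (by positivity)).sub_const ((c * x ^ κ + 1)⁻¹)
    rw [sub_self] at h5
    simpa using h5.abs

lemma aux_low (κ c : ℝ) (hc : 0 < c)
    (lam : ℕ → ℝ) (hpos : ∀ n, 1 ≤ n → 0 < lam n)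
    (hasym : Tendsto (fun n : ℕ => lam n / (c * (n : ℝ) ^ κ)) atTop (nhds 1)) :
    ∃ a > 0, ∀ n : ℕ, a * ((n:ℝ) + 1) ^ κ ≤ lam (n + 1) := by
  have h1 := ((hasym.comp (Filter.tendsto_add_atTop_nat 1)).inv₀ one_ne_zero).bddAbove_range
  obtain ⟨B, hB⟩ := h1
  have hB' : ∀ n : ℕ, (c * ((n:ℝ) + 1) ^ κ) ≤ B * lam (n + 1) := by
    intro n
    have := hB ⟨n, rfl⟩
    simp only [Function.comp, inv_div] at this
    push_cast at this
    rwa [div_le_iff₀ (hpos _ (by omega))] at this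
  have hB0 : 0 < B := by
    have h := hB' 0
    have h2 := hpos 1 le_rfl
    simp at h
    by_contra hn
    push Not at hn
    nlinarith
  refine ⟨c / B, by positivity, fun n => ?_⟩
  have := hB' n
  rw [div_mul_eq_mul_div, div_le_iff₀ hB0]
  linarith

lemma aux_repr (z : ℂ) (hz : z ≠ 0) :
    z = -Complex.exp ((Real.log ‖z‖ : ℝ) + ((branchArg z - Real.pi : ℝ) : ℂ) * Complex.I) := by
  have h1 : Complex.exp ((branchArg z : ℂ) * Complex.I) = Complex.exp ((Complex.arg z : ℂ) * Complex.I) := by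
    unfold branchArg
    split_ifs
    · push_cast
      rw [add_mul, Complex.exp_add, Complex.exp_two_pi_mul_I, mul_one]
    · rfl
  rw [Complex.exp_add]
  push_cast
  rw [sub_mul, Complex.exp_sub, Complex.exp_pi_mul_I, h1,
    ← Complex.ofReal_exp, Real.exp_log (norm_pos_iff.2 hz), div_neg, div_one, mul_neg, neg_neg,
    Complex.norm_mul_exp_arg_mul_I]

lemma aux_const (κ c : ℝ) (hκ : 1 < κ) (hc : 0 < c) (L b : ℝ) :
    Complex.exp (((1 / κ - 1 : ℝ) : ℂ) * ((L : ℂ) + ((b - Real.pi : ℝ) : ℂ) * Complex.I)) *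
        ((c ^ (-1 / κ) * (Real.pi / (κ * Real.sin (Real.pi / κ))) : ℝ) : ℂ) =
    (((2 * Real.pi : ℝ) : ℂ) * Complex.I /
            ((1 - Complex.exp (((2 * Real.pi : ℝ) : ℂ) * Complex.I / (κ : ℂ))) * (κ : ℂ) *
              ((c ^ (1 / κ) : ℝ) : ℂ))) *
      Complex.exp (((1 / κ - 1 : ℝ) : ℂ) * ((L : ℂ) + (b : ℂ) * Complex.I)) := by
  have hκ0 : 0 < κ := by linarith
  have hκC : (κ : ℂ) ≠ 0 := by exact_mod_cast hκ0.ne'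
  have hsin : Real.sin (Real.pi / κ) ≠ 0 := by
    apply ne_of_gt
    apply Real.sin_pos_of_pos_of_lt_pi (by positivity)
    exact div_lt_self Real.pi_pos hκ
  set e := Complex.exp (((Real.pi / κ : ℝ) : ℂ) * Complex.I) with he
  have hene : e ≠ 0 := Complex.exp_ne_zero _
  have h1 : Complex.exp (((2 * Real.pi : ℝ) : ℂ) * Complex.I / (κ : ℂ)) = e * e := by
    rw [he, ← Complex.exp_add]; congr 1; push_cast; ring
  have h2 : ((Real.sin (Real.pi / κ) : ℝ) : ℂ) = (e⁻¹ - e) * Complex.I / 2 := by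
    rw [Complex.ofReal_sin, Complex.sin, he, ← Complex.exp_neg, neg_mul]
  have h3 : Complex.exp (((1 / κ - 1 : ℝ) : ℂ) * ((L : ℂ) + ((b - Real.pi : ℝ) : ℂ) * Complex.I)) =
      Complex.exp (((1 / κ - 1 : ℝ) : ℂ) * ((L : ℂ) + (b : ℂ) * Complex.I)) * (-e⁻¹) := by
    have : -e⁻¹ = Complex.exp (-(((Real.pi / κ : ℝ) : ℂ) * Complex.I) + Real.pi * Complex.I) := by
      rw [Complex.exp_add, Complex.exp_pi_mul_I, Complex.exp_neg]; ring
    rw [this, ← Complex.exp_add]; congr 1; push_cast; ring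
  have h4 : c ^ (-1 / κ) = (c ^ (1 / κ))⁻¹ := by
    rw [← Real.rpow_neg hc.le]; congr 1; ring
  have hcp : ((c ^ (1 / κ) : ℝ) : ℂ) ≠ 0 := by
    have : 0 < c ^ (1 / κ) := by positivity
    exact_mod_cast this.ne'
  have hs' : (e⁻¹ - e) * Complex.I / 2 ≠ 0 := by rw [← h2]; exact_mod_cast hsin
  have hs2 : e⁻¹ - e ≠ 0 := by
    intro h; apply hs'; rw [h]; simp
  have h5 : e⁻¹ - e = e⁻¹ * (1 - e * e) := by field_simp
  have hs3 : 1 - e * e ≠ 0 := by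
    intro h; apply hs2; rw [h5, h, mul_zero]
  rw [h1, h3, h4, mul_assoc, mul_comm]
  congr 1
  rw [Complex.ofReal_mul, Complex.ofReal_inv, Complex.ofReal_div, Complex.ofReal_mul κ, h2]
  rw [h5]
  have hI := Complex.I_sq
  push_cast
  field_simp
  rw [hI]; ring

lemma aux_delta (θ₁ θ₂ : ℝ) (hθ₁ : 0 < θ₁) (hθ : θ₁ ≤ θ₂) (hθ₂ : θ₂ < 2 * Real.pi) :
    ∃ δ > 0, ∀ θ, θ₁ ≤ θ → θ ≤ θ₂ → δ ≤ Real.cos ((θ - Real.pi) / 2) := by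
  obtain ⟨x, hx, hmin⟩ := (isCompact_Icc (a := θ₁) (b := θ₂)).exists_isMinOn ⟨θ₁, le_rfl, hθ⟩
    (f := fun θ => Real.cos ((θ - Real.pi) / 2)) (by fun_prop)
  refine ⟨_, ?_, fun θ h1 h2 => hmin ⟨h1, h2⟩⟩
  apply Real.cos_pos_of_mem_Ioo
  constructor <;> linarith [hx.1, hx.2]

lemma aux_main
    (κ c : ℝ) (hκ : 1 < κ) (hc : 0 < c)
    (lam : ℕ → ℝ) (hpos : ∀ n, 1 ≤ n → 0 < lam n)
    (hasym : Tendsto (fun n : ℕ => lam n / (c * (n : ℝ) ^ κ)) atTop (nhds 1))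
    (θ₁ θ₂ : ℝ) (hθ₁ : 0 < θ₁) (hθ : θ₁ ≤ θ₂) (hθ₂ : θ₂ < 2 * Real.pi) :
    ∀ ε > 0, ∃ R > 0, ∀ z : ℂ, R ≤ ‖z‖ → θ₁ ≤ branchArg z → branchArg z ≤ θ₂ →
      ‖(∑' n : ℕ, ((lam (n + 1) : ℂ) - z)⁻¹) -
          (((2 * Real.pi : ℝ) : ℂ) * Complex.I /
            ((1 - Complex.exp (((2 * Real.pi : ℝ) : ℂ) * Complex.I / (κ : ℂ))) * (κ : ℂ) *
              ((c ^ (1 / κ) : ℝ) : ℂ))) * branchCpow z (1 / κ - 1)‖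
        ≤ ε * ‖z‖ ^ (1 / κ - 1) := by
  intro ε hε
  have hκ0 : 0 < κ := by linarith
  obtain ⟨a, ha, hlow⟩ := aux_low κ c hc lam hpos hasym
  obtain ⟨δ, hδ, hcos⟩ := aux_delta θ₁ θ₂ hθ₁ hθ hθ₂
  have hE := (aux_E κ c hκ hc lam a ha hlow hasym).comp
    (tendsto_rpow_atTop (y := 1 / κ) (by positivity))
  have hE2 := hE.eventually (gt_mem_nhds (show 0 < ε * δ ^ 2 by positivity))
  obtain ⟨R, hR⟩ := Filter.eventually_atTop.1 hE2
  refine ⟨max R 1, by positivity, fun z hz h1 h2 => ?_⟩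
  have hr1 : 1 ≤ ‖z‖ := (le_max_right _ _).trans hz
  have hEz := hR ‖z‖ ((le_max_left _ _).trans hz)
  simp only [Function.comp] at hEz
  have hr0 : 0 < ‖z‖ := by linarith
  have hz0 : z ≠ 0 := norm_pos_iff.1 hr0
  have hrep := aux_repr z hz0
  set r := ‖z‖ with hr
  set L := Real.log r with hL
  set b := branchArg z with hb
  set s : ℂ := (L : ℂ) + ((b - Real.pi : ℝ) : ℂ) * Complex.I with hs
  have hbabs : |b - Real.pi| < Real.pi := by rw [abs_lt]; constructor <;> linarith
  have him : |s.im| < Real.pi := by simpa [hs] using hbabs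
  have hlb : ∀ t : ℝ, 0 ≤ t → δ * (t + r) ≤ ‖(t : ℂ) - z‖ := by
    intro t ht
    rw [hrep, sub_neg_eq_add]
    have := aux_lower L (b - Real.pi) t hbabs.le
    rw [Real.exp_log hr0] at this
    refine le_trans ?_ this
    exact mul_le_mul_of_nonneg_right (hcos b h1 h2) (by linarith)
  -- the model integral
  have hmod := aux_strip κ c hκ hc s him
  rw [aux_const κ c hκ hc L b] at hmod
  have hmodint := (aux_deriv κ c hκ hc s him).1
  have hzz : ∀ w : ℂ, w + Complex.exp s = w - z := fun w => by rw [hrep]; ring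
  simp only [hzz] at hmod hmodint
  -- measurability and integrability of the step function
  have hlowt : ∀ t ∈ Ioi (0:ℝ), a * t ^ κ ≤ lam (⌊t⌋₊ + 1) := by
    intro t ht
    have ht' : 0 < t := ht
    refine le_trans ?_ (hlow _)
    gcongr
    exact (Nat.lt_floor_add_one _).le
  have hmeas : Measurable (fun t : ℝ => lam (⌊t⌋₊ + 1)) :=
    (measurable_from_top (f := fun n : ℕ => lam (n + 1))).comp (by fun_prop)
  have hi1 := (aux_real κ a r hκ ha hr0).1
  have hi2 := (aux_real κ c r hκ hc hr0).1
  have hstepR : IntegrableOn (fun t : ℝ => (lam (⌊t⌋₊ + 1) + r)⁻¹) (Ioi 0) := by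
    refine Integrable.mono' hi1 (Measurable.aestronglyMeasurable (by fun_prop)) ?_
    refine (ae_restrict_iff' measurableSet_Ioi).2 (Filter.Eventually.of_forall fun t ht => ?_)
    have ht' : 0 < t := ht
    have := hlowt t ht
    have h2 : 0 < a * t ^ κ := by positivity
    rw [Real.norm_eq_abs, abs_of_nonneg (by apply inv_nonneg.2; linarith)]
    gcongr
  have hstep : IntegrableOn (fun t : ℝ => ((lam (⌊t⌋₊ + 1) : ℂ) - z)⁻¹) (Ioi 0) := by
    refine Integrable.mono' (hstepR.const_mul δ⁻¹) (Measurable.aestronglyMeasurable (by fun_prop)) ?_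
    refine (ae_restrict_iff' measurableSet_Ioi).2 (Filter.Eventually.of_forall fun t ht => ?_)
    have hp := hpos (⌊t⌋₊ + 1) (by omega)
    rw [norm_inv, ← mul_inv]
    exact inv_anti₀ (by positivity) (hlb _ hp.le)
  rw [aux_floor (fun n => ((lam (n + 1) : ℂ) - z)⁻¹) hstep]
  unfold branchCpow
  rw [← hb, ← hr, ← hL, ← hmod, ← integral_sub hstep hmodint]
  -- bound by the real integral
  have hbound : ‖∫ t in Ioi (0:ℝ), (((lam (⌊t⌋₊ + 1) : ℂ) - z)⁻¹ - (((c * t ^ κ : ℝ) : ℂ) - z)⁻¹)‖ ≤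
      ∫ t in Ioi (0:ℝ), (δ ^ 2)⁻¹ * |(lam (⌊t⌋₊ + 1) + r)⁻¹ - (c * t ^ κ + r)⁻¹| := by
    apply norm_integral_le_of_norm_le ((hstepR.sub hi2).abs.const_mul _)
    refine (ae_restrict_iff' measurableSet_Ioi).2 (Filter.Eventually.of_forall fun t ht => ?_)
    have ht' : 0 < t := ht
    have hp := hpos (⌊t⌋₊ + 1) (by omega)
    have hy : 0 < c * t ^ κ := by positivity
    have b1 := hlb _ hp.le
    have b2 := hlb _ hy.le
    have n1 : ((lam (⌊t⌋₊ + 1) : ℂ) - z) ≠ 0 := by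
      rw [← norm_pos_iff]; exact lt_of_lt_of_le (by positivity) b1
    have n2 : (((c * t ^ κ : ℝ) : ℂ) - z) ≠ 0 := by
      rw [← norm_pos_iff]; exact lt_of_lt_of_le (by positivity) b2
    rw [Pi.sub_apply, inv_sub_inv n1 n2, inv_sub_inv (by positivity) (by positivity), norm_div, abs_div, norm_mul,
      sub_sub_sub_cancel_right, add_sub_add_right_eq_sub, ← Complex.ofReal_sub, Complex.norm_real,
      Real.norm_eq_abs, abs_of_pos (a := (lam (⌊t⌋₊ + 1) + r) * (c * t ^ κ + r)) (by positivity)]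
    calc _ ≤ |c * t ^ κ - lam (⌊t⌋₊ + 1)| / ((δ * (lam (⌊t⌋₊ + 1) + r)) * (δ * (c * t ^ κ + r))) := by
          gcongr
      _ = _ := by field_simp
  refine hbound.trans ?_
  rw [integral_const_mul]
  -- rescale
  set N := r ^ (1 / κ) with hN
  have hN0 : 0 < N := by positivity
  have hNκ : N ^ κ = r := by
    rw [hN, ← Real.rpow_mul hr0.le, one_div_mul_cancel hκ0.ne', Real.rpow_one]
  have hsc := integral_comp_mul_left_Ioi
    (fun t : ℝ => |(lam (⌊t⌋₊ + 1) + r)⁻¹ - (c * t ^ κ + r)⁻¹|) 0 hN0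
  rw [mul_zero] at hsc
  have hsc2 : ∫ x in Ioi (0:ℝ), |(lam (⌊N * x⌋₊ + 1) + r)⁻¹ - (c * (N * x) ^ κ + r)⁻¹| =
      r⁻¹ * ∫ x in Ioi (0:ℝ), |(lam (⌊x * N⌋₊ + 1) / N ^ κ + 1)⁻¹ - (c * x ^ κ + 1)⁻¹| := by
    rw [← integral_const_mul]
    refine setIntegral_congr_fun measurableSet_Ioi fun x hx => ?_
    have hx' : 0 < x := hx
    rw [Real.mul_rpow hN0.le hx'.le, hNκ, mul_comm N x]
    have hp := hpos (⌊x * N⌋₊ + 1) (by omega)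
    rw [← abs_of_pos (inv_pos.2 hr0), ← abs_mul, mul_sub, ← mul_inv,
      ← mul_inv]
    congr 3
    · field_simp
    · ring
  rw [hsc2, smul_eq_mul] at hsc
  have hfin : ∫ t in Ioi (0:ℝ), |(lam (⌊t⌋₊ + 1) + r)⁻¹ - (c * t ^ κ + r)⁻¹| =
     (N * r⁻¹) * ∫ x in Ioi (0:ℝ), |(lam (⌊x * N⌋₊ + 1) / N ^ κ + 1)⁻¹ - (c * x ^ κ + 1)⁻¹| := by
    rw [mul_assoc, hsc, mul_inv_cancel_left₀ hN0.ne']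
  have hNr : N * r⁻¹ = r ^ (1 / κ - 1) := by
    rw [Real.rpow_sub_one hr0.ne', div_eq_mul_inv]
  rw [hfin, hNr]
  have hP : 0 < r ^ (1 / κ - 1) := by positivity
  calc _ ≤ (δ ^ 2)⁻¹ * (r ^ (1 / κ - 1) * (ε * δ ^ 2)) := by gcongr
    _ = _ := by field_simp

end Aux

/-- Abelian theorem (Proposition 3.2 of the paper): if `λ_n = c n^κ (1 + o(1))` with
`κ > 1`, `c > 0`, then, uniformly for `z → ∞` in any closed sector
`θ₁ ≤ arg z ≤ θ₂` with `0 < θ₁ ≤ θ₂ < 2π`,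
`∑_{n≥1} (λ_n − z)⁻¹ = (2πi/((1 − e^{2πi/κ}) κ c^{1/κ})) z^{1/κ−1} + o(|z|^{1/κ−1})`. -/
theorem abelian_resolvent_trace_asymptotics
    (κ c : ℝ) (hκ : 1 < κ) (hc : 0 < c)
    (lam : ℕ → ℝ) (hpos : ∀ n, 1 ≤ n → 0 < lam n)
    (hasym : Tendsto (fun n : ℕ => lam n / (c * (n : ℝ) ^ κ)) atTop (nhds 1))
    (θ₁ θ₂ : ℝ) (hθ₁ : 0 < θ₁) (hθ : θ₁ ≤ θ₂) (hθ₂ : θ₂ < 2 * Real.pi) :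
    ∀ ε > 0, ∃ R > 0, ∀ z : ℂ, R ≤ ‖z‖ → θ₁ ≤ branchArg z → branchArg z ≤ θ₂ →
      ‖(∑' n : ℕ, ((lam (n + 1) : ℂ) - z)⁻¹) -
          (((2 * Real.pi : ℝ) : ℂ) * Complex.I /
            ((1 - Complex.exp (((2 * Real.pi : ℝ) : ℂ) * Complex.I / (κ : ℂ))) * (κ : ℂ) *
              ((c ^ (1 / κ) : ℝ) : ℂ))) * branchCpow z (1 / κ - 1)‖
        ≤ ε * ‖z‖ ^ (1 / κ - 1) := by
  exact aux_main κ c hκ hc lam hpos hasym θ₁ θ₂ hθ₁ hθ hθ₂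
end

section
/- Let κ > 1 and c > 0, and let (λ_n)_{n≥1} be a sequence of positive real numbers satisfying λ_n = c n^κ (1 + o(1)) as n → ∞. Then the infinite product P(z) = ∏_{n=1}^∞ (1 − z/λ_n) converges locally uniformly on ℂ to an entire function, and for z tending to infinity in any closed sector {z : θ₁ ≤ arg z ≤ θ₂} with 0 < θ₁ ≤ θ₂ < 2π one has ln |P(z)| = Re( −(2πi/((1 − e^{2πi/κ}) c^{1/κ})) · z^{1/κ} ) + o(|z|^{1/κ}), uniformly in the sector. In particular P is an entire function of order 1/κ. -/
open Filter

open MeasureTheory Set Topology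

lemma aux_cosHalf_pos {φ₀ : ℝ} (h0 : 0 ≤ φ₀) (h : φ₀ < Real.pi) : 0 < Real.cos (φ₀ / 2) :=
  Real.cos_pos_of_mem_Ioo ⟨by linarith [Real.pi_pos], by linarith⟩

lemma aux_norm_lower {φ φ₀ t : ℝ} (h : |φ| ≤ φ₀) (h' : φ₀ < Real.pi) (ht : 0 ≤ t) :
    Real.cos (φ₀ / 2) * (1 + t) ≤ ‖1 + Complex.exp (φ * Complex.I) * t‖ := by
  have h0 : 0 ≤ φ₀ := (abs_nonneg _).trans h
  have h1 : Real.cos (φ₀ / 2) ≤ Real.cos (φ / 2) := by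
    rw [← Real.cos_abs (φ / 2)]
    apply Real.cos_le_cos_of_nonneg_of_le_pi (abs_nonneg _) (by linarith)
    rw [abs_div, abs_of_pos (by norm_num : (0:ℝ) < 2)]; linarith
  have h2 : 0 < Real.cos (φ₀ / 2) := aux_cosHalf_pos h0 h'
  have h3 : Real.cos φ = 2 * Real.cos (φ / 2) ^ 2 - 1 := by
    rw [← Real.cos_two_mul]; congr 1; ring
  refine (mul_le_mul_of_nonneg_right h1 (by linarith)).trans ?_
  have h6 : 0 ≤ Real.cos (φ / 2) * (1 + t) := mul_nonneg (h2.le.trans h1) (by linarith)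
  refine (sq_le_sq₀ h6 (norm_nonneg _)).1 ?_
  rw [Complex.sq_norm, Complex.normSq_apply]
  simp [Complex.exp_ofReal_mul_I_re, Complex.exp_ofReal_mul_I_im]
  have h4 := Real.sin_sq_add_cos_sq φ
  have h5 := Real.cos_sq_le_one (φ / 2)
  have : (1 + Real.cos φ * t) * (1 + Real.cos φ * t) + Real.sin φ * t * (Real.sin φ * t)
    = 1 + 2 * Real.cos φ * t + t ^ 2 := by linear_combination t ^ 2 * h4
  rw [this, h3]
  nlinarith [mul_nonneg (sub_nonneg.2 h5) (sq_nonneg (1 - t))]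

lemma aux_slit {φ t : ℝ} (h : |φ| < Real.pi) (ht : 0 ≤ t) :
    1 + Complex.exp (φ * Complex.I) * t ∈ Complex.slitPlane := by
  rw [Complex.mem_slitPlane_iff]
  by_cases hs : Real.sin φ * t = 0
  · left
    rcases mul_eq_zero.1 hs with hs | hs
    · have := (Real.sin_eq_zero_iff_of_lt_of_lt (abs_lt.1 h).1 (abs_lt.1 h).2).1 hs
      subst this; simp; linarith
    · subst hs; simp
  · right
    simpa [Complex.exp_ofReal_mul_I_im] using hs

lemma aux_log_bound {φ φ₀ x : ℝ} (h : |φ| ≤ φ₀) (h' : φ₀ < Real.pi) (hx : 0 ≤ x) :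
    ‖Complex.log (1 + Complex.exp (φ * Complex.I) * x)‖
      ≤ (Real.cos (φ₀ / 2))⁻¹ * Real.log (1 + x) := by
  have hδ : 0 < Real.cos (φ₀ / 2) := aux_cosHalf_pos ((abs_nonneg _).trans h) h'
  have hd : ∀ t : ℝ, 0 ≤ t → HasDerivAt
      (fun t : ℝ => Complex.log (1 + Complex.exp (φ * Complex.I) * t))
      (Complex.exp (φ * Complex.I) / (1 + Complex.exp (φ * Complex.I) * t)) t := by
    intro t ht
    have h1 : HasDerivAt (fun t : ℝ => (1 + Complex.exp (φ * Complex.I) * (t : ℂ)))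
        (Complex.exp (φ * Complex.I)) t := by
      simpa using ((Complex.ofRealCLM.hasDerivAt (x := t)).const_mul
        (Complex.exp (φ * Complex.I))).const_add 1
    exact h1.clog_real (aux_slit (h.trans_lt h') ht)
  have hB : ∀ t : ℝ, 0 ≤ t → HasDerivAt
      (fun t : ℝ => (Real.cos (φ₀ / 2))⁻¹ * Real.log (1 + t))
      ((Real.cos (φ₀ / 2))⁻¹ * (1 / (1 + t))) t := by
    intro t ht
    exact (((hasDerivAt_id t).const_add 1).log (by simp; linarith)).const_mul _
  refine image_norm_le_of_norm_deriv_right_le_deriv_boundary' (a := 0) (b := x)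
    (f := fun t : ℝ => Complex.log (1 + Complex.exp (φ * Complex.I) * t))
    (fun t ht => (hd t ht.1).continuousAt.continuousWithinAt)
    (fun t ht => (hd t ht.1).hasDerivWithinAt)
    (B := fun t : ℝ => (Real.cos (φ₀ / 2))⁻¹ * Real.log (1 + t)) (by simp)
    (fun t ht => (hB t ht.1).continuousAt.continuousWithinAt)
    (fun t ht => (hB t ht.1).hasDerivWithinAt) ?_ ⟨hx, le_rfl⟩
  intro t ht
  rw [norm_div, Complex.norm_exp_ofReal_mul_I, ← one_div, one_div_mul_one_div]
  have := ht.1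
  exact one_div_le_one_div_of_le (by positivity) (aux_norm_lower h h' ht.1)

lemma aux_log_le_rpow {σ x : ℝ} (hσ : 0 < σ) (hσ1 : σ ≤ 1) (hx : 0 ≤ x) :
    Real.log (1 + x) ≤ x ^ σ / σ := by
  rw [le_div_iff₀ hσ, mul_comm, ← Real.log_rpow (by linarith)]
  have h1 := Real.rpow_add_le_add_rpow zero_le_one hx hσ.le hσ1
  rw [Real.one_rpow] at h1
  have h2 : 0 < (1 + x) ^ σ := by positivity
  have := Real.log_le_sub_one_of_pos h2
  linarith

/-- integrability criterion -/
lemma aux_integrable {κ K : ℝ} (hκ : 1 < κ) {E : Type*} [NormedAddCommGroup E] {f : ℝ → E}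
    (hm : AEStronglyMeasurable f (volume.restrict (Ioi 0)))
    (h1 : ∀ s > 0, ‖f s‖ ≤ K * s ^ (-κ)) (h2 : ∀ s > 0, ‖f s‖ ≤ K * s ^ (-(1/2) : ℝ)) :
    IntegrableOn f (Ioi 0) := by
  rw [← Ioc_union_Ioi_eq_Ioi (zero_le_one' ℝ)]
  apply IntegrableOn.union
  · have : IntegrableOn (fun s : ℝ => K * s ^ (-(1/2) : ℝ)) (Ioc 0 1) := by
      have := (intervalIntegral.intervalIntegrable_rpow' (a := 0) (b := 1)
        (r := (-(1/2) : ℝ)) (by norm_num)).const_mul K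
      rwa [intervalIntegrable_iff_integrableOn_Ioc_of_le zero_le_one] at this
    refine Integrable.mono' this (hm.mono_set Ioc_subset_Ioi_self) ?_
    filter_upwards [ae_restrict_mem measurableSet_Ioc] with s hs using h2 s hs.1
  · have : IntegrableOn (fun s : ℝ => K * s ^ (-κ)) (Ioi 1) :=
      (integrableOn_Ioi_rpow_of_lt (by linarith) zero_lt_one).const_mul K
    refine Integrable.mono' this (hm.mono_set (Ioi_subset_Ioi zero_le_one)) ?_
    filter_upwards [ae_restrict_mem measurableSet_Ioi] with s hs
      using h1 s (zero_lt_one.trans hs)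

lemma aux_log_bounds {κ b : ℝ} (hκ : 1 < κ) (hb : 0 < b) :
    ∃ K : ℝ, 0 < K ∧ ∀ s > 0, Real.log (1 + b * s ^ (-κ)) ≤ K * s ^ (-κ) ∧
      Real.log (1 + b * s ^ (-κ)) ≤ K * s ^ (-(1/2) : ℝ) := by
  have hσ : 0 < 1 / (2 * κ) := by positivity
  refine ⟨max b (b ^ (1 / (2 * κ)) / (1 / (2 * κ))), by positivity, fun s hs => ⟨?_, ?_⟩⟩
  · have := aux_log_le_rpow zero_lt_one le_rfl (x := b * s ^ (-κ)) (by positivity)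
    rw [Real.rpow_one, div_one] at this
    exact this.trans (mul_le_mul_of_nonneg_right (le_max_left _ _) (by positivity))
  · have := aux_log_le_rpow hσ (by rw [div_le_one (by positivity)]; linarith)
      (x := b * s ^ (-κ)) (by positivity)
    refine this.trans ?_
    rw [Real.mul_rpow hb.le (by positivity), ← Real.rpow_mul hs.le]
    rw [show -κ * (1 / (2 * κ)) = (-(1/2) : ℝ) by field_simp]
    rw [mul_div_right_comm]
    exact mul_le_mul_of_nonneg_right (le_max_right _ _) (by positivity)

lemma aux_log_integrable {κ b : ℝ} (hκ : 1 < κ) (hb : 0 < b) :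
    IntegrableOn (fun s : ℝ => Real.log (1 + b * s ^ (-κ))) (Ioi 0) := by
  obtain ⟨K, hK, h⟩ := aux_log_bounds hκ hb
  have hnn : ∀ s > 0, 0 ≤ Real.log (1 + b * s ^ (-κ)) := fun s hs =>
    Real.log_nonneg (by have : 0 < b * s ^ (-κ) := by positivity
                        linarith)
  refine aux_integrable (K := K) hκ (Measurable.aestronglyMeasurable (by fun_prop)) ?_ ?_
  · intro s hs
    rw [Real.norm_of_nonneg (hnn s hs)]; exact (h s hs).1
  · intro s hs
    rw [Real.norm_of_nonneg (hnn s hs)]; exact (h s hs).2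

/-- sum as integral -/
lemma aux_sum_eq_integral {g : ℕ → ℂ}
    (hi : IntegrableOn (fun t : ℝ => g ⌈t⌉₊) (Ioi 0)) :
    HasSum (fun n : ℕ => g (n + 1)) (∫ t in Ioi (0:ℝ), g ⌈t⌉₊) := by
  have hU : (⋃ n : ℕ, Ioc (n : ℝ) (n + 1)) = Ioi 0 := by
    ext t
    simp only [mem_iUnion, mem_Ioc, mem_Ioi]
    constructor
    · rintro ⟨n, h1, h2⟩
      exact (Nat.cast_nonneg n).trans_lt h1
    · intro ht
      have h0 : 0 < ⌈t⌉₊ := Nat.ceil_pos.2 ht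
      refine ⟨⌈t⌉₊ - 1, ?_, ?_⟩
      · rw [← Nat.lt_ceil]; omega
      · have : ((⌈t⌉₊ - 1 : ℕ) : ℝ) + 1 = (⌈t⌉₊ : ℝ) := by
          rw [← Nat.cast_add_one]; congr 1; omega
        rw [this]; exact Nat.le_ceil t
  have hd : Pairwise (Function.onFun Disjoint (fun n : ℕ => Ioc (n : ℝ) (n + 1))) := by
    have := (Nat.mono_cast (α := ℝ)).pairwise_disjoint_on_Ioc_succ
    simpa using this
  have := hasSum_integral_iUnion (μ := volume) (f := fun t : ℝ => g ⌈t⌉₊)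
    (s := fun n : ℕ => Ioc (n : ℝ) (n + 1)) (fun _ => measurableSet_Ioc) hd (by rwa [hU])
  rw [hU] at this
  convert! this using 2 with n
  rw [setIntegral_congr_fun (g := fun _ => g (n + 1)) measurableSet_Ioc]
  · simp
  · intro t ht
    have : ⌈t⌉₊ = n + 1 := by
      rw [Nat.ceil_eq_iff (by omega)]; simpa using ht
    simp only [this]

/-- The limiting integral as a function of the angle. -/
noncomputable def auxF (κ b φ : ℝ) : ℂ :=
  ∫ s in Ioi (0:ℝ), Complex.log (1 + Complex.exp (φ * Complex.I) * ((b * s ^ (-κ) : ℝ) : ℂ))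

lemma aux_meas_log (κ b : ℝ) (w : ℂ) :
    Measurable (fun s : ℝ => Complex.log (1 + w * ((b * s ^ (-κ) : ℝ) : ℂ))) := by
  fun_prop

lemma aux_F_integrable {κ b φ : ℝ} (hκ : 1 < κ) (hb : 0 < b) (hφ : |φ| < Real.pi) :
    IntegrableOn (fun s : ℝ =>
      Complex.log (1 + Complex.exp (φ * Complex.I) * ((b * s ^ (-κ) : ℝ) : ℂ))) (Ioi 0) := by
  refine Integrable.mono' ((aux_log_integrable hκ hb).const_mul (Real.cos (|φ| / 2))⁻¹)
    (aux_meas_log _ _ _).aestronglyMeasurable ?_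
  filter_upwards [ae_restrict_mem measurableSet_Ioi] with s hs
  have hs : 0 < s := hs
  exact aux_log_bound le_rfl hφ (by positivity)

lemma aux_frac_bound {φ φ₀ x : ℝ} (h : |φ| ≤ φ₀) (h' : φ₀ < Real.pi) (hx : 0 ≤ x) :
    ‖Complex.exp (φ * Complex.I) * x / (1 + Complex.exp (φ * Complex.I) * x)‖
      ≤ (Real.cos (φ₀ / 2))⁻¹ * Real.log (1 + x) := by
  have hδ : 0 < Real.cos (φ₀ / 2) := aux_cosHalf_pos ((abs_nonneg _).trans h) h'
  rw [norm_div, norm_mul, Complex.norm_exp_ofReal_mul_I, one_mul, Complex.norm_real,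
    Real.norm_of_nonneg hx]
  have h1 : x / (1 + x) ≤ Real.log (1 + x) := by
    have := Real.one_sub_inv_le_log_of_pos (by linarith : 0 < 1 + x)
    have h2 : x / (1 + x) = 1 - (1 + x)⁻¹ := by field_simp; ring
    linarith
  calc x / ‖1 + Complex.exp (φ * Complex.I) * x‖ ≤ x / (Real.cos (φ₀ / 2) * (1 + x)) :=
        div_le_div_of_nonneg_left hx (by positivity) (aux_norm_lower h h' hx)
    _ = (Real.cos (φ₀ / 2))⁻¹ * (x / (1 + x)) := by field_simp
    _ ≤ _ := mul_le_mul_of_nonneg_left h1 (by positivity)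

lemma aux_frac_integrable {κ b φ : ℝ} (hκ : 1 < κ) (hb : 0 < b) (hφ : |φ| < Real.pi) :
    IntegrableOn (fun s : ℝ => Complex.exp (φ * Complex.I) * ((b * s ^ (-κ) : ℝ) : ℂ) /
      (1 + Complex.exp (φ * Complex.I) * ((b * s ^ (-κ) : ℝ) : ℂ))) (Ioi 0) := by
  refine Integrable.mono' ((aux_log_integrable hκ hb).const_mul (Real.cos (|φ| / 2))⁻¹)
    (Measurable.aestronglyMeasurable (by fun_prop)) ?_
  filter_upwards [ae_restrict_mem measurableSet_Ioi] with s hs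
  have hs : 0 < s := hs
  exact aux_frac_bound le_rfl hφ (by positivity)

lemma aux_ibp {κ b φ : ℝ} (hκ : 1 < κ) (hb : 0 < b) (hφ : |φ| < Real.pi) :
    auxF κ b φ = κ * ∫ s in Ioi (0:ℝ), Complex.exp (φ * Complex.I) * ((b * s ^ (-κ) : ℝ) : ℂ) /
      (1 + Complex.exp (φ * Complex.I) * ((b * s ^ (-κ) : ℝ) : ℂ)) := by
  set w := Complex.exp (φ * Complex.I) with hw
  obtain ⟨K, hK, hKb⟩ := aux_log_bounds hκ hb
  have hδ : 0 < Real.cos (|φ| / 2) := aux_cosHalf_pos (abs_nonneg _) hφ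
  set f : ℝ → ℂ := fun s => (s : ℂ) * Complex.log (1 + w * ((b * s ^ (-κ) : ℝ) : ℂ)) with hf
  have hnorm : ∀ s > 0, ‖f s‖ ≤ s * ((Real.cos (|φ| / 2))⁻¹ * Real.log (1 + b * s ^ (-κ))) := by
    intro s hs
    rw [hf, norm_mul, Complex.norm_real, Real.norm_of_nonneg hs.le]
    exact mul_le_mul_of_nonneg_left (aux_log_bound le_rfl hφ (by positivity)) hs.le
  have hderiv : ∀ s ∈ Ioi (0:ℝ), HasDerivAt f
      (Complex.log (1 + w * ((b * s ^ (-κ) : ℝ) : ℂ)) -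
        κ * (w * ((b * s ^ (-κ) : ℝ) : ℂ) / (1 + w * ((b * s ^ (-κ) : ℝ) : ℂ)))) s := by
    intro s hs
    have hs : 0 < s := hs
    have hsl : 1 + w * ((b * s ^ (-κ) : ℝ) : ℂ) ∈ Complex.slitPlane :=
      aux_slit hφ (by positivity)
    have h1 : HasDerivAt (fun s : ℝ => b * s ^ (-κ)) (b * (-κ * s ^ (-κ - 1))) s :=
      (Real.hasDerivAt_rpow_const (Or.inl hs.ne')).const_mul b
    have h2 := ((h1.ofReal_comp.const_mul w).const_add 1).clog_real hsl
    have h3 := (Complex.ofRealCLM.hasDerivAt (x := s)).mul h2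
    convert! h3 using 1
    have hne := Complex.slitPlane_ne_zero hsl
    have h4 : s ^ (-κ - 1) = s ^ (-κ) / s := Real.rpow_sub_one hs.ne' _
    simp only [Complex.ofRealCLM_apply, Complex.ofReal_one, one_mul]
    rw [h4]
    have hsC : (s : ℂ) ≠ 0 := by exact_mod_cast hs.ne'
    push_cast at hne ⊢
    field_simp
    ring
  have hInt : IntegrableOn (fun s : ℝ => Complex.log (1 + w * ((b * s ^ (-κ) : ℝ) : ℂ)) -
        κ * (w * ((b * s ^ (-κ) : ℝ) : ℂ) / (1 + w * ((b * s ^ (-κ) : ℝ) : ℂ)))) (Ioi 0) :=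
    (aux_F_integrable hκ hb hφ).sub ((aux_frac_integrable hκ hb hφ).const_mul _)
  have hcont : ContinuousWithinAt f (Ici 0) 0 := by
    have hf0 : f 0 = 0 := by simp [hf]
    rw [ContinuousWithinAt, hf0]
    have hlim : Tendsto (fun s : ℝ => (Real.cos (|φ| / 2))⁻¹ * K * s ^ (1/2 : ℝ))
        (𝓝[Ici 0] 0) (𝓝 0) := by
      have : Continuous (fun s : ℝ => (Real.cos (|φ| / 2))⁻¹ * K * s ^ (1/2 : ℝ)) :=
        continuous_const.mul (Real.continuous_rpow_const (by norm_num))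
      have := this.tendsto 0
      rw [Real.zero_rpow (by norm_num), mul_zero] at this
      exact this.mono_left nhdsWithin_le_nhds
    refine squeeze_zero_norm' ?_ hlim
    filter_upwards [self_mem_nhdsWithin] with s hs
    rcases eq_or_lt_of_le (show (0:ℝ) ≤ s from hs) with h | h
    · rw [← h, hf0]; simp
    · refine (hnorm s h).trans ?_
      have := (hKb s h).2
      have h5 : s * s ^ (-(1/2) : ℝ) = s ^ (1/2 : ℝ) := by
        nth_rewrite 1 [← Real.rpow_one s]
        rw [← Real.rpow_add h]; norm_num
      calc s * ((Real.cos (|φ| / 2))⁻¹ * Real.log (1 + b * s ^ (-κ)))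
          ≤ s * ((Real.cos (|φ| / 2))⁻¹ * (K * s ^ (-(1/2) : ℝ))) := by gcongr
        _ = (Real.cos (|φ| / 2))⁻¹ * K * (s * s ^ (-(1/2) : ℝ)) := by ring
        _ = _ := by rw [h5]
  have htop : Tendsto f atTop (𝓝 0) := by
    have hlim : Tendsto (fun s : ℝ => (Real.cos (|φ| / 2))⁻¹ * K * s ^ (-(κ - 1)))
        atTop (𝓝 0) := by
      have := (tendsto_rpow_neg_atTop (by linarith : 0 < κ - 1)).const_mul
        ((Real.cos (|φ| / 2))⁻¹ * K)
      rwa [mul_zero] at this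
    refine squeeze_zero_norm' ?_ hlim
    filter_upwards [eventually_gt_atTop 0] with s h
    refine (hnorm s h).trans ?_
    have := (hKb s h).1
    have h5 : s * s ^ (-κ) = s ^ (-(κ - 1)) := by
      nth_rewrite 1 [← Real.rpow_one s]
      rw [← Real.rpow_add h]; congr 1; ring
    calc s * ((Real.cos (|φ| / 2))⁻¹ * Real.log (1 + b * s ^ (-κ)))
        ≤ s * ((Real.cos (|φ| / 2))⁻¹ * (K * s ^ (-κ))) := by gcongr
      _ = (Real.cos (|φ| / 2))⁻¹ * K * (s * s ^ (-κ)) := by ring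
      _ = _ := by rw [h5]
  have key := integral_Ioi_of_hasDerivAt_of_tendsto hcont hderiv hInt htop
  rw [integral_sub (aux_F_integrable hκ hb hφ) ((aux_frac_integrable hκ hb hφ).const_mul _),
    integral_const_mul] at key
  have hf0 : f 0 = 0 := by simp [hf]
  rw [hf0, sub_zero] at key
  exact sub_eq_zero.1 key

lemma aux_F_deriv {κ b φ : ℝ} (hκ : 1 < κ) (hb : 0 < b) (hφ : |φ| < Real.pi) :
    HasDerivAt (auxF κ b) (Complex.I * (1 / κ) * auxF κ b φ) φ := by
  set φ₀ := (|φ| + Real.pi) / 2 with hφ₀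
  have h1 : |φ| < φ₀ := by rw [hφ₀]; linarith
  have h2 : φ₀ < Real.pi := by rw [hφ₀]; linarith
  have hs : {ψ : ℝ | |ψ| < φ₀} ∈ 𝓝 φ :=
    (isOpen_lt continuous_abs continuous_const).mem_nhds h1
  have := (hasDerivAt_integral_of_dominated_loc_of_deriv_le (μ := volume.restrict (Ioi (0:ℝ)))
    (F := fun ψ s => Complex.log (1 + Complex.exp ((ψ : ℝ) * Complex.I) *
      ((b * s ^ (-κ) : ℝ) : ℂ)))
    (F' := fun ψ s => Complex.I * (Complex.exp ((ψ : ℝ) * Complex.I) * ((b * s ^ (-κ) : ℝ) : ℂ) /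
      (1 + Complex.exp ((ψ : ℝ) * Complex.I) * ((b * s ^ (-κ) : ℝ) : ℂ))))
    (bound := fun s => (Real.cos (φ₀ / 2))⁻¹ * Real.log (1 + b * s ^ (-κ)))
    hs (Eventually.of_forall fun ψ => (aux_meas_log _ _ _).aestronglyMeasurable)
    (aux_F_integrable hκ hb hφ)
    (Measurable.aestronglyMeasurable (by fun_prop)) ?_
    ((aux_log_integrable hκ hb).const_mul _) ?_).2
  · rw [integral_const_mul] at this
    convert! this using 1
    rw [aux_ibp hκ hb hφ]
    have : (κ : ℂ) ≠ 0 := by exact_mod_cast (by linarith : κ ≠ 0)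
    field_simp
  · filter_upwards [ae_restrict_mem measurableSet_Ioi] with s hs ψ hψ
    have hs : 0 < s := hs
    rw [norm_mul, Complex.norm_I, one_mul]
    exact aux_frac_bound (le_of_lt hψ) h2 (by positivity)
  · filter_upwards [ae_restrict_mem measurableSet_Ioi] with s hs ψ hψ
    have hs : 0 < s := hs
    have hψ : |ψ| < φ₀ := hψ
    have h3 : HasDerivAt (fun ψ : ℝ => Complex.exp ((ψ : ℂ) * Complex.I))
        (Complex.exp (ψ * Complex.I) * Complex.I) ψ := by
      simpa using ((Complex.ofRealCLM.hasDerivAt (x := ψ)).mul_const Complex.I).cexp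
    have h4 := ((h3.mul_const ((b * s ^ (-κ) : ℝ) : ℂ)).const_add 1).clog_real
      (aux_slit (hψ.trans h2) (by positivity))
    convert! h4 using 1
    ring

lemma aux_F_eq {κ b φ : ℝ} (hκ : 1 < κ) (hb : 0 < b) (hφ : |φ| < Real.pi) :
    auxF κ b φ = Complex.exp (Complex.I * (1 / κ) * φ) * auxF κ b 0 := by
  have hd : ∀ ψ ∈ Ioo (-Real.pi) Real.pi, HasDerivAt
      (fun ψ : ℝ => Complex.exp (-(Complex.I * (1 / κ) * ψ)) * auxF κ b ψ) 0 ψ := by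
    intro ψ hψ
    have h1 : HasDerivAt (fun ψ : ℝ => Complex.exp (-(Complex.I * (1 / κ) * ψ)))
        (Complex.exp (-(Complex.I * (1 / κ) * ψ)) * -(Complex.I * (1 / κ))) ψ := by
      simpa using ((Complex.ofRealCLM.hasDerivAt (x := ψ)).const_mul (Complex.I * (1 / κ))).neg.cexp
    convert! h1.mul (aux_F_deriv hκ hb (abs_lt.2 hψ)) using 1
    ring
  have := isOpen_Ioo.is_const_of_deriv_eq_zero isPreconnected_Ioo
    (fun ψ hψ => (hd ψ hψ).differentiableAt.differentiableWithinAt)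
    (fun ψ hψ => (hd ψ hψ).deriv) (abs_lt.1 hφ)
    (show (0:ℝ) ∈ Ioo (-Real.pi) Real.pi from ⟨by linarith [Real.pi_pos], Real.pi_pos⟩)
  simp only [Complex.ofReal_zero, mul_zero, neg_zero, Complex.exp_zero, one_mul] at this
  rw [← this, ← mul_assoc, ← Complex.exp_add]
  simp

lemma aux_beta {κ c : ℝ} (hκ : 1 < κ) (hc : 0 < c)
    (hi : IntegrableOn (fun s : ℝ => (1 + c * s ^ κ)⁻¹) (Ioi 0)) :
    ∫ s in Ioi (0:ℝ), (1 + c * s ^ κ)⁻¹ =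
      (1 / κ) * (Real.pi / Real.sin (Real.pi / κ)) * (c ^ (1 / κ))⁻¹ := by
  have hpos : ∀ s ∈ Ioi (0:ℝ), 0 < 1 + c * s ^ κ := by
    intro s hs
    have hs : 0 < s := hs
    positivity
  have hin : ∀ s ∈ Ioi (0:ℝ), ∫ u in Ioi (0:ℝ), Real.exp (-(1 + c * s ^ κ) * u)
      = (1 + c * s ^ κ)⁻¹ := by
    intro s hs
    rw [integral_exp_mul_Ioi (by linarith [hpos s hs])]
    rw [mul_zero, Real.exp_zero, neg_div_neg_eq, one_div]
  have hprod : Integrable (Function.uncurry (fun s u : ℝ => Real.exp (-(1 + c * s ^ κ) * u)))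
      ((volume.restrict (Ioi (0:ℝ))).prod (volume.restrict (Ioi (0:ℝ)))) := by
    rw [integrable_prod_iff (Measurable.aestronglyMeasurable (by fun_prop))]
    constructor
    · filter_upwards [ae_restrict_mem measurableSet_Ioi] with s hs
      exact integrableOn_exp_mul_Ioi (neg_lt_zero.2 (hpos s hs)) 0
    · refine hi.congr_fun (fun s hs => ?_) measurableSet_Ioi
      simp only [Function.uncurry, Real.norm_eq_abs, Real.abs_exp]
      exact (hin s hs).symm
  have hsw := integral_integral_swap hprod
  rw [setIntegral_congr_fun measurableSet_Ioi hin] at hsw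
  rw [hsw]
  have hκ0 : 0 < κ := by linarith
  have hρ1 : 1 / κ < 1 := by rw [div_lt_one hκ0]; exact hκ
  have h2 : ∀ u ∈ Ioi (0:ℝ), ∫ s in Ioi (0:ℝ), Real.exp (-(1 + c * s ^ κ) * u) =
      ((c ^ (1 / κ))⁻¹ * Real.Gamma (1 / κ + 1)) *
        (Real.exp (-u) * u ^ ((1 - 1 / κ) - 1)) := by
    intro u hu
    have hu : 0 < u := hu
    have : ∀ s : ℝ, Real.exp (-(1 + c * s ^ κ) * u)
        = Real.exp (-u) * Real.exp (-(c * u) * s ^ κ) := by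
      intro s; rw [← Real.exp_add]; ring_nf
    simp only [this]
    rw [integral_const_mul, integral_exp_neg_mul_rpow hκ0 (by positivity),
      Real.mul_rpow hc.le hu.le, ← Real.rpow_neg hc.le]
    rw [show -1 / κ = -(1 / κ) by ring, show 1 - 1 / κ - 1 = -(1 / κ) by ring]
    ring
  rw [setIntegral_congr_fun measurableSet_Ioi h2, integral_const_mul,
    ← Real.Gamma_eq_integral (by linarith), Real.Gamma_add_one (by positivity)]
  have := Real.Gamma_mul_Gamma_one_sub (1 / κ)
  rw [show Real.pi * (1 / κ) = Real.pi / κ by ring] at this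
  rw [← this]; ring

lemma aux_F_zero {κ c : ℝ} (hκ : 1 < κ) (hc : 0 < c) :
    auxF κ c⁻¹ 0 = ((Real.pi / Real.sin (Real.pi / κ) * (c ^ (1 / κ))⁻¹ : ℝ) : ℂ) := by
  have h0 : |(0:ℝ)| < Real.pi := by simpa using Real.pi_pos
  have hcc : 0 < c⁻¹ := by positivity
  have heq : EqOn (fun s : ℝ => Complex.exp ((0:ℝ) * Complex.I) * ((c⁻¹ * s ^ (-κ) : ℝ) : ℂ) /
      (1 + Complex.exp ((0:ℝ) * Complex.I) * ((c⁻¹ * s ^ (-κ) : ℝ) : ℂ)))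
      (fun s : ℝ => (((1 + c * s ^ κ)⁻¹ : ℝ) : ℂ)) (Ioi 0) := by
    intro s hs
    have hs : 0 < s := hs
    have h1 : (c⁻¹ * s ^ (-κ)) / (1 + c⁻¹ * s ^ (-κ)) = (1 + c * s ^ κ)⁻¹ := by
      rw [Real.rpow_neg hs.le]
      have : 0 < s ^ κ := by positivity
      field_simp
      ring
    simp only [← h1]
    simp
  have hInt := (aux_frac_integrable hκ hcc h0).congr_fun heq measurableSet_Ioi
  have hInt' : IntegrableOn (fun s : ℝ => (1 + c * s ^ κ)⁻¹) (Ioi 0) := by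
    exact hInt.re
  rw [aux_ibp hκ hcc h0, setIntegral_congr_fun measurableSet_Ioi heq, integral_complex_ofReal,
    aux_beta hκ hc hInt']
  have : (κ : ℂ) ≠ 0 := by exact_mod_cast (by linarith : κ ≠ 0)
  push_cast
  field_simp

lemma aux_lam_lower {κ c : ℝ} (hc : 0 < c) {lam : ℕ → ℝ}
    (hasym : Tendsto (fun n : ℕ => lam n / (c * (n : ℝ) ^ κ)) atTop (nhds 1)) :
    ∃ B : ℝ, 0 < B ∧ ∀ n : ℕ, 1 ≤ n → (lam n)⁻¹ ≤ B * (n : ℝ) ^ (-κ) := by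
  have h := hasym.inv₀ one_ne_zero
  obtain ⟨B, hB⟩ := h.bddAbove_range
  refine ⟨(max B 1) * c⁻¹, by positivity, fun n hn => ?_⟩
  have h1 : (lam n / (c * (n : ℝ) ^ κ))⁻¹ ≤ max B 1 :=
    (hB ⟨n, rfl⟩).trans (le_max_left _ _)
  have hn' : (0:ℝ) < n := by exact_mod_cast hn
  have hk : 0 < (n : ℝ) ^ κ := by positivity
  rw [inv_div, div_eq_mul_inv] at h1
  rw [Real.rpow_neg hn'.le]
  calc (lam n)⁻¹ = (c * (n : ℝ) ^ κ * (lam n)⁻¹) * (c⁻¹ * ((n : ℝ) ^ κ)⁻¹) := by field_simp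
    _ ≤ max B 1 * (c⁻¹ * ((n : ℝ) ^ κ)⁻¹) := mul_le_mul_of_nonneg_right h1 (by positivity)
    _ = _ := by ring

lemma aux_rescaled_bound {κ B : ℝ} (hκ : 1 < κ) (hB : 0 < B) {lam : ℕ → ℝ}
    (hlow : ∀ n : ℕ, 1 ≤ n → (lam n)⁻¹ ≤ B * (n : ℝ) ^ (-κ)) {r s : ℝ} (hr : 0 < r) (hs : 0 < s) :
    r / lam ⌈r ^ (1 / κ) * s⌉₊ ≤ B * s ^ (-κ) := by
  have hy : 0 < r ^ (1 / κ) * s := by positivity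
  have h1 := hlow ⌈r ^ (1 / κ) * s⌉₊ (Nat.ceil_pos.2 hy)
  have h2 : (⌈r ^ (1 / κ) * s⌉₊ : ℝ) ^ (-κ) ≤ (r ^ (1 / κ) * s) ^ (-κ) :=
    Real.rpow_le_rpow_of_nonpos hy (Nat.le_ceil _) (by linarith)
  have h3 : (r ^ (1 / κ) * s) ^ (-κ) = r⁻¹ * s ^ (-κ) := by
    rw [Real.mul_rpow (by positivity) hs.le, ← Real.rpow_mul hr.le,
      show 1 / κ * -κ = -1 by field_simp, Real.rpow_neg_one]
  rw [div_eq_mul_inv]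
  calc r * (lam ⌈r ^ (1 / κ) * s⌉₊)⁻¹ ≤ r * (B * (r⁻¹ * s ^ (-κ))) := by
        rw [← h3]
        exact mul_le_mul_of_nonneg_left
          (h1.trans (mul_le_mul_of_nonneg_left h2 hB.le)) hr.le
    _ = _ := by field_simp

lemma aux_rescaled_log_bound {κ B : ℝ} (hκ : 1 < κ) (hB : 0 < B) {lam : ℕ → ℝ}
    (hpos : ∀ n, 1 ≤ n → 0 < lam n)
    (hlow : ∀ n : ℕ, 1 ≤ n → (lam n)⁻¹ ≤ B * (n : ℝ) ^ (-κ)) {r s φ φ₀ : ℝ}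
    (hr : 0 < r) (hs : 0 < s) (h : |φ| ≤ φ₀) (h' : φ₀ < Real.pi) :
    ‖Complex.log (1 + Complex.exp (φ * Complex.I) *
      ((r / lam ⌈r ^ (1 / κ) * s⌉₊ : ℝ) : ℂ))‖
      ≤ (Real.cos (φ₀ / 2))⁻¹ * Real.log (1 + B * s ^ (-κ)) := by
  have hy : 0 < r ^ (1 / κ) * s := by positivity
  have hl := hpos ⌈r ^ (1 / κ) * s⌉₊ (Nat.ceil_pos.2 hy)
  have hδ : 0 < Real.cos (φ₀ / 2) := aux_cosHalf_pos ((abs_nonneg _).trans h) h'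
  refine (aux_log_bound h h' (by positivity)).trans ?_
  refine mul_le_mul_of_nonneg_left ?_ (by positivity)
  refine Real.log_le_log (by positivity) ?_
  have := aux_rescaled_bound hκ hB hlow hr hs
  linarith

lemma aux_rescaled_meas (κ r : ℝ) (lam : ℕ → ℝ) (w : ℂ) :
    Measurable (fun s : ℝ => Complex.log (1 + w *
      ((r / lam ⌈r ^ (1 / κ) * s⌉₊ : ℝ) : ℂ))) := by
  have h1 : Measurable (fun n : ℕ => Complex.log (1 + w * ((r / lam n : ℝ) : ℂ))) :=
    measurable_of_countable _
  exact h1.comp (Nat.measurable_ceil.comp (measurable_const.mul measurable_id))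

lemma aux_hasSum {κ B : ℝ} (hκ : 1 < κ) (hB : 0 < B) {lam : ℕ → ℝ}
    (hpos : ∀ n, 1 ≤ n → 0 < lam n)
    (hlow : ∀ n : ℕ, 1 ≤ n → (lam n)⁻¹ ≤ B * (n : ℝ) ^ (-κ)) {r φ : ℝ}
    (hr : 0 < r) (h : |φ| < Real.pi) :
    HasSum (fun n : ℕ => Complex.log (1 + Complex.exp (φ * Complex.I) *
      ((r / lam (n + 1) : ℝ) : ℂ)))
      (((r ^ (1 / κ) : ℝ) : ℂ) * ∫ s in Ioi (0:ℝ), Complex.log (1 + Complex.exp (φ * Complex.I) *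
      ((r / lam ⌈r ^ (1 / κ) * s⌉₊ : ℝ) : ℂ))) := by
  have hrp : 0 < r ^ (1 / κ) := by positivity
  have hInt : IntegrableOn (fun s : ℝ => Complex.log (1 + Complex.exp (φ * Complex.I) *
      ((r / lam ⌈r ^ (1 / κ) * s⌉₊ : ℝ) : ℂ))) (Ioi 0) := by
    refine Integrable.mono' ((aux_log_integrable hκ hB).const_mul (Real.cos (|φ| / 2))⁻¹)
      (aux_rescaled_meas _ _ _ _).aestronglyMeasurable ?_
    filter_upwards [ae_restrict_mem measurableSet_Ioi] with s hs
    exact aux_rescaled_log_bound hκ hB hpos hlow hr hs le_rfl h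
  have hint2 := (integrableOn_Ioi_comp_mul_left_iff (fun t : ℝ => Complex.log (1 +
      Complex.exp (φ * Complex.I) * ((r / lam ⌈t⌉₊ : ℝ) : ℂ))) 0 hrp).1 hInt
  rw [mul_zero] at hint2
  have hsum := aux_sum_eq_integral
    (g := fun n => Complex.log (1 + Complex.exp (φ * Complex.I) * ((r / lam n : ℝ) : ℂ))) hint2
  have hcv := integral_comp_mul_left_Ioi (fun t : ℝ => Complex.log (1 +
      Complex.exp (φ * Complex.I) * ((r / lam ⌈t⌉₊ : ℝ) : ℂ))) 0 hrp
  rw [mul_zero] at hcv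
  rw [hcv, Complex.real_smul, ← mul_assoc, ← Complex.ofReal_mul, mul_inv_cancel₀ hrp.ne',
    Complex.ofReal_one, one_mul]
  exact hsum

lemma aux_pointwise {κ c : ℝ} (hκ : 1 < κ) (hc : 0 < c) {lam : ℕ → ℝ}
    (hasym : Tendsto (fun n : ℕ => lam n / (c * (n : ℝ) ^ κ)) atTop (nhds 1))
    {r : ℕ → ℝ} (hr : Tendsto r atTop atTop) {s : ℝ} (hs : 0 < s) :
    Tendsto (fun k => r k / lam ⌈r k ^ (1 / κ) * s⌉₊) atTop (𝓝 (c⁻¹ * s ^ (-κ))) := by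
  have hκ0 : 0 < κ := by linarith
  have hy : Tendsto (fun k => r k ^ (1 / κ) * s) atTop atTop :=
    ((tendsto_rpow_atTop (by positivity : 0 < 1 / κ)).comp hr).atTop_mul_const hs
  have hn : Tendsto (fun k => ⌈r k ^ (1 / κ) * s⌉₊) atTop atTop :=
    tendsto_nat_ceil_atTop.comp hy
  have h1 := (hasym.comp hn).inv₀ one_ne_zero
  have h2 := (tendsto_nat_ceil_div_atTop (R := ℝ)).comp hy
  have h3 : Tendsto (fun k => ((⌈r k ^ (1 / κ) * s⌉₊ : ℝ) / (r k ^ (1 / κ) * s)) ^ (-κ)) atTop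
      (𝓝 (1 ^ (-κ))) := h2.rpow_const (Or.inl one_ne_zero)
  have h4 := (h1.mul h3).mul_const (c⁻¹ * s ^ (-κ))
  rw [Real.one_rpow, inv_one, one_mul, one_mul] at h4
  refine h4.congr' ?_
  filter_upwards [hr.eventually_gt_atTop 0] with k hk
  have hy : 0 < r k ^ (1 / κ) * s := by positivity
  have hnp : 0 < (⌈r k ^ (1 / κ) * s⌉₊ : ℝ) := by exact_mod_cast Nat.ceil_pos.2 hy
  have h5 : (r k ^ (1 / κ) * s) ^ (-κ) = (r k)⁻¹ * s ^ (-κ) := by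
    rw [Real.mul_rpow (by positivity) hs.le, ← Real.rpow_mul hk.le,
      show 1 / κ * -κ = -1 by field_simp, Real.rpow_neg_one]
  rw [Real.div_rpow hnp.le hy.le, h5]
  simp only [Function.comp]
  rw [Real.rpow_neg hnp.le]
  have h6 : 0 < s ^ (-κ) := by positivity
  have h7 : 0 < (⌈r k ^ (1 / κ) * s⌉₊ : ℝ) ^ κ := by positivity
  generalize (⌈r k ^ (1 / κ) * s⌉₊ : ℝ) ^ κ = N at *
  rw [inv_div]
  field_simp

lemma aux_dct {κ c : ℝ} (hκ : 1 < κ) (hc : 0 < c) {lam : ℕ → ℝ}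
    (hpos : ∀ n, 1 ≤ n → 0 < lam n)
    (hasym : Tendsto (fun n : ℕ => lam n / (c * (n : ℝ) ^ κ)) atTop (nhds 1))
    {r φ : ℕ → ℝ} {φ' : ℝ} (hr0 : ∀ k, 0 < r k) (hr : Tendsto r atTop atTop)
    (hφ : Tendsto φ atTop (𝓝 φ')) {φ₀ : ℝ} (hφ₀ : φ₀ < Real.pi) (hb : ∀ k, |φ k| ≤ φ₀) :
    Tendsto (fun k => ∫ s in Ioi (0:ℝ), Complex.log (1 + Complex.exp (φ k * Complex.I) *
      ((r k / lam ⌈r k ^ (1 / κ) * s⌉₊ : ℝ) : ℂ))) atTop (𝓝 (auxF κ c⁻¹ φ')) := by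
  obtain ⟨B, hB, hlow⟩ := aux_lam_lower hc hasym
  have hφ' : |φ'| < Real.pi :=
    (le_of_tendsto hφ.abs (Eventually.of_forall hb)).trans_lt hφ₀
  refine tendsto_integral_of_dominated_convergence
    (fun s => (Real.cos (φ₀ / 2))⁻¹ * Real.log (1 + B * s ^ (-κ)))
    (fun k => (aux_rescaled_meas _ _ _ _).aestronglyMeasurable)
    ((aux_log_integrable hκ hB).const_mul _) ?_ ?_
  · intro k
    filter_upwards [ae_restrict_mem measurableSet_Ioi] with s hs
    exact aux_rescaled_log_bound hκ hB hpos hlow (hr0 k) hs (hb k) hφ₀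
  · filter_upwards [ae_restrict_mem measurableSet_Ioi] with s hs
    have hs : 0 < s := hs
    have hp := aux_pointwise hκ hc hasym hr hs
    have hp' := (Complex.continuous_ofReal.tendsto _).comp hp
    have he : Tendsto (fun k => Complex.exp (φ k * Complex.I)) atTop
        (𝓝 (Complex.exp (φ' * Complex.I))) := by
      have : Continuous (fun x : ℝ => Complex.exp (x * Complex.I)) := by fun_prop
      exact (this.tendsto φ').comp hφ
    exact ((he.mul hp').const_add 1).clog (aux_slit hφ' (by positivity))

/-- The canonical product. -/
noncomputable def auxP (lam : ℕ → ℝ) (z : ℂ) : ℂ := ∏' n : ℕ, (1 + -(z / (lam (n + 1) : ℂ)))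

lemma aux_summable {κ B : ℝ} (hκ : 1 < κ) {lam : ℕ → ℝ}
    (hpos : ∀ n, 1 ≤ n → 0 < lam n)
    (hlow : ∀ n : ℕ, 1 ≤ n → (lam n)⁻¹ ≤ B * (n : ℝ) ^ (-κ)) :
    Summable (fun n : ℕ => (lam (n + 1))⁻¹) := by
  have h1 : Summable (fun n : ℕ => (n : ℝ) ^ (-κ)) := Real.summable_nat_rpow.2 (by linarith)
  have h2 := ((summable_nat_add_iff 1).2 h1).mul_left B
  refine Summable.of_nonneg_of_le (fun n => (inv_pos.2 (hpos _ (by omega))).le)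
    (fun n => hlow (n + 1) (by omega)) h2

lemma aux_P_tendsto {κ B : ℝ} (hκ : 1 < κ) {lam : ℕ → ℝ}
    (hpos : ∀ n, 1 ≤ n → 0 < lam n)
    (hlow : ∀ n : ℕ, 1 ≤ n → (lam n)⁻¹ ≤ B * (n : ℝ) ^ (-κ)) :
    TendstoLocallyUniformly
        (fun N : ℕ => fun z : ℂ => ∏ n ∈ Finset.range N, (1 - z / (lam (n + 1) : ℂ)))
        (auxP lam) atTop := by
  simp only [sub_eq_add_neg]
  refine (hasProdLocallyUniformly_of_forall_compact (f := fun (n : ℕ) (z : ℂ) =>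
    1 + -(z / (lam (n + 1) : ℂ))) (g := auxP lam) ?_).tendstoLocallyUniformly_finsetRange
  intro K hK
  obtain ⟨M, hM⟩ := hK.isBounded.exists_norm_le
  refine Summable.hasProdUniformlyOn_nat_one_add hK
    ((aux_summable hκ hpos hlow).mul_left M) (Eventually.of_forall fun n z hz => ?_) ?_
  · have := hpos (n + 1) (by omega)
    rw [norm_neg, norm_div, Complex.norm_real, Real.norm_of_nonneg this.le, div_eq_mul_inv]
    exact mul_le_mul_of_nonneg_right (hM z hz) (by positivity)
  · intro n
    fun_prop

lemma aux_P_mono {lam : ℕ → ℝ} (hpos : ∀ n, 1 ≤ n → 0 < lam n)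
    (hP : TendstoLocallyUniformly
        (fun N : ℕ => fun z : ℂ => ∏ n ∈ Finset.range N, (1 - z / (lam (n + 1) : ℂ)))
        (auxP lam) atTop) {z : ℂ} {r : ℝ} (h : ‖z‖ ≤ r) :
    ‖auxP lam z‖ ≤ ‖auxP lam (-(r : ℂ))‖ := by
  have h1 := (hP.tendstoLocallyUniformlyOn (s := univ)).tendsto_at (mem_univ z)
  have h2 := (hP.tendstoLocallyUniformlyOn (s := univ)).tendsto_at (mem_univ (-(r : ℂ)))
  refine le_of_tendsto_of_tendsto' h1.norm h2.norm (fun N => ?_)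
  simp only [norm_prod]
  refine Finset.prod_le_prod (fun _ _ => norm_nonneg _) (fun n _ => ?_)
  have hl := hpos (n + 1) (by omega)
  have hr : 0 ≤ r := (norm_nonneg _).trans h
  have h3 : (1 - -(r : ℂ) / (lam (n + 1) : ℂ)) = ((1 + r / lam (n + 1) : ℝ) : ℂ) := by
    push_cast; ring
  rw [h3, Complex.norm_real, Real.norm_of_nonneg (by positivity)]
  refine (norm_sub_le _ _).trans ?_
  rw [norm_one, norm_div, Complex.norm_real, Real.norm_of_nonneg hl.le]
  gcongr

lemma aux_polar {z : ℂ} :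
    z = -(Complex.exp (((branchArg z - Real.pi : ℝ) : ℂ) * Complex.I) * (‖z‖ : ℂ)) := by
  have h1 : Complex.exp ((branchArg z : ℂ) * Complex.I) = Complex.exp (z.arg * Complex.I) := by
    unfold branchArg
    split_ifs
    · push_cast
      rw [add_mul, Complex.exp_add, Complex.exp_two_pi_mul_I, mul_one]
    · rfl
  push_cast
  rw [sub_mul, Complex.exp_sub, Complex.exp_pi_mul_I, h1, div_neg, div_one, neg_mul, neg_neg,
    mul_comm, Complex.norm_mul_exp_arg_mul_I]

lemma aux_log_P {κ B : ℝ} (hκ : 1 < κ) (hB : 0 < B) {lam : ℕ → ℝ}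
    (hpos : ∀ n, 1 ≤ n → 0 < lam n)
    (hlow : ∀ n : ℕ, 1 ≤ n → (lam n)⁻¹ ≤ B * (n : ℝ) ^ (-κ)) {z : ℂ} {φ : ℝ}
    (hr : 0 < ‖z‖) (hφ : φ = branchArg z - Real.pi) (h : |φ| < Real.pi) :
    Real.log ‖auxP lam z‖ = ‖z‖ ^ (1 / κ) *
      (∫ s in Ioi (0:ℝ), Complex.log (1 + Complex.exp (φ * Complex.I) *
      ((‖z‖ / lam ⌈‖z‖ ^ (1 / κ) * s⌉₊ : ℝ) : ℂ))).re := by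
  have hs := aux_hasSum hκ hB hpos hlow hr h
  have h1 : ∀ n : ℕ, 1 + -(z / (lam (n + 1) : ℂ)) =
      1 + Complex.exp (φ * Complex.I) * ((‖z‖ / lam (n + 1) : ℝ) : ℂ) := by
    intro n
    nth_rewrite 1 [aux_polar (z := z)]
    rw [← hφ]
    push_cast
    ring
  have h2 := Complex.cexp_tsum_eq_tprod
    (f := fun n : ℕ => 1 + Complex.exp (φ * Complex.I) * ((‖z‖ / lam (n + 1) : ℝ) : ℂ))
    (fun n => Complex.slitPlane_ne_zero (aux_slit h
      (div_nonneg hr.le (hpos (n + 1) (by omega)).le))) hs.summable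
  rw [auxP]
  simp only [h1]
  rw [← h2, hs.tsum_eq, Complex.norm_exp, Real.log_exp, Complex.re_ofReal_mul]

lemma aux_main_term {κ c : ℝ} (hκ : 1 < κ) (hc : 0 < c) {z : ℂ} {φ : ℝ}
    (hr : 0 < ‖z‖) (hφ : φ = branchArg z - Real.pi) (h : |φ| < Real.pi) :
    -((((2 * Real.pi : ℝ) : ℂ) * Complex.I) /
        ((1 - Complex.exp (((2 * Real.pi : ℝ) : ℂ) * Complex.I / (κ : ℂ))) *
          ((c ^ (1 / κ) : ℝ) : ℂ))) * branchCpow z (1 / κ)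
      = ((‖z‖ ^ (1 / κ) : ℝ) : ℂ) * auxF κ c⁻¹ φ := by
  have hκ0 : 0 < κ := by linarith
  have hκC : (κ : ℂ) ≠ 0 := by exact_mod_cast hκ0.ne'
  have hsin : 0 < Real.sin (Real.pi / κ) := by
    apply Real.sin_pos_of_pos_of_lt_pi (by positivity)
    rw [div_lt_iff₀ hκ0]; nlinarith [Real.pi_pos]
  rw [aux_F_eq hκ (by positivity) h, aux_F_zero hκ hc]
  have hcp : ((c ^ (1 / κ) : ℝ) : ℂ) ≠ 0 := by
    exact_mod_cast (by positivity : (c ^ (1 / κ)) ≠ 0)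
  have hb : branchCpow z (1 / κ) = ((‖z‖ ^ (1 / κ) : ℝ) : ℂ) *
      (Complex.exp (Complex.I * (1 / κ) * φ) * Complex.exp (Real.pi / κ * Complex.I)) := by
    rw [branchCpow, Real.rpow_def_of_pos hr, Complex.ofReal_exp, ← Complex.exp_add,
      ← Complex.exp_add, hφ]
    congr 1
    push_cast
    field_simp
    ring
  rw [hb]
  set E := Complex.exp (Real.pi / κ * Complex.I) with hE
  have hE0 : E ≠ 0 := Complex.exp_ne_zero _
  have hE2 : Complex.exp (((2 * Real.pi : ℝ) : ℂ) * Complex.I / (κ : ℂ)) = E * E := by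
    rw [hE, ← Complex.exp_add]; congr 1; push_cast; ring
  have hS : ((Real.sin (Real.pi / κ) : ℝ) : ℂ) = (E⁻¹ - E) * Complex.I / 2 := by
    rw [Complex.ofReal_sin, Complex.sin, hE, ← Complex.exp_neg]
    push_cast
    rw [neg_mul]
  have hS0 : (E⁻¹ - E) * Complex.I / 2 ≠ 0 := by
    rw [← hS]; exact_mod_cast hsin.ne'
  have hd : 1 - E * E ≠ 0 := by
    intro h0
    apply hS0
    have : E⁻¹ - E = (1 - E * E) / E := by field_simp
    rw [this, h0]; simp
  rw [hE2, Complex.ofReal_mul (Real.pi / _), Complex.ofReal_div Real.pi, hS, Complex.ofReal_inv]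
  have : E⁻¹ - E = (1 - E * E) / E := by field_simp
  rw [this]
  have hI := Complex.I_ne_zero
  push_cast at hcp ⊢
  field_simp
  rw [Complex.I_sq]; ring

lemma aux_asymp {κ c : ℝ} (hκ : 1 < κ) (hc : 0 < c) {lam : ℕ → ℝ}
    (hpos : ∀ n, 1 ≤ n → 0 < lam n)
    (hasym : Tendsto (fun n : ℕ => lam n / (c * (n : ℝ) ^ κ)) atTop (nhds 1))
    {θ₁ θ₂ : ℝ} (h1 : 0 < θ₁) (h2 : θ₂ < 2 * Real.pi) {ε : ℝ} (hε : 0 < ε) :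
    ∃ R > 0, ∀ z : ℂ, R ≤ ‖z‖ → θ₁ ≤ branchArg z → branchArg z ≤ θ₂ →
      |Real.log ‖auxP lam z‖ - ‖z‖ ^ (1 / κ) * (auxF κ c⁻¹ (branchArg z - Real.pi)).re|
        ≤ ε * ‖z‖ ^ (1 / κ) := by
  by_contra hcon
  push Not at hcon
  obtain ⟨B, hB, hlow⟩ := aux_lam_lower hc hasym
  have hk : ∀ k : ℕ, (0:ℝ) < (k : ℝ) + 1 := fun k => by positivity
  choose z hz1 hz2 hz3 hz4 using fun k : ℕ => hcon ((k : ℝ) + 1) (hk k)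
  obtain ⟨θ, hθ, g, hg, hlim⟩ := (isCompact_Icc (a := θ₁) (b := θ₂)).tendsto_subseq
    (x := fun k => branchArg (z k)) (fun k => ⟨hz2 k, hz3 k⟩)
  set φ₀ := max (Real.pi - θ₁) (θ₂ - Real.pi) with hφ₀
  have hφπ : φ₀ < Real.pi := max_lt (by linarith) (by linarith)
  have hb : ∀ x, θ₁ ≤ x → x ≤ θ₂ → |x - Real.pi| ≤ φ₀ := by
    intro x hx1 hx2
    rw [abs_le]
    constructor
    · have := le_max_left (Real.pi - θ₁) (θ₂ - Real.pi); linarith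
    · have := le_max_right (Real.pi - θ₁) (θ₂ - Real.pi); linarith
  have hr0 : ∀ k, 0 < ‖z (g k)‖ := fun k => (hk _).trans_le (hz1 _)
  have hr : Tendsto (fun k => ‖z (g k)‖) atTop atTop := by
    have h0 : Tendsto (fun k => ‖z k‖) atTop atTop :=
      tendsto_atTop_mono hz1 (tendsto_atTop_add_const_right _ _ tendsto_natCast_atTop_atTop)
    exact h0.comp hg.tendsto_atTop
  have hφ : Tendsto (fun k => branchArg (z (g k)) - Real.pi) atTop (𝓝 (θ - Real.pi)) :=
    hlim.sub_const _
  have hd := aux_dct hκ hc hpos hasym hr0 hr hφ hφπ (fun k => hb _ (hz2 _) (hz3 _))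
  have hF : Tendsto (fun k => auxF κ c⁻¹ (branchArg (z (g k)) - Real.pi)) atTop
      (𝓝 (auxF κ c⁻¹ (θ - Real.pi))) :=
    (aux_F_deriv hκ (by positivity) ((hb θ hθ.1 hθ.2).trans_lt hφπ)).continuousAt.tendsto.comp hφ
  have hdiff := (hd.sub hF).norm
  rw [sub_self, norm_zero] at hdiff
  obtain ⟨k, hk⟩ := (hdiff.eventually (gt_mem_nhds hε)).exists
  have h4 := hz4 (g k)
  rw [aux_log_P hκ hB hpos hlow (hr0 k) rfl ((hb _ (hz2 _) (hz3 _)).trans_lt hφπ),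
    ← mul_sub, ← Complex.sub_re, abs_mul, abs_of_pos (Real.rpow_pos_of_pos (hr0 k) _),
    mul_comm] at h4
  have h5 := lt_of_mul_lt_mul_left h4 (Real.rpow_nonneg (norm_nonneg _) _)
  exact absurd ((h5.trans_le (Complex.abs_re_le_norm _)).trans hk) (lt_irrefl _)

lemma aux_branchArg_neg {r : ℝ} (hr : 0 < r) : branchArg (-(r : ℂ)) = Real.pi := by
  have : Complex.arg (-(r : ℂ)) = Real.pi := by
    rw [← Complex.ofReal_neg]; exact Complex.arg_ofReal_of_neg (by linarith)
  rw [branchArg, this, if_neg (not_le.2 Real.pi_pos)]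

lemma aux_neg {κ c : ℝ} (hκ : 1 < κ) (hc : 0 < c) {lam : ℕ → ℝ}
    (hpos : ∀ n, 1 ≤ n → 0 < lam n)
    (hasym : Tendsto (fun n : ℕ => lam n / (c * (n : ℝ) ^ κ)) atTop (nhds 1)) :
    ∃ A > 0, ∀ ε > 0, ∃ R > 0, ∀ r : ℝ, R ≤ r →
      |Real.log ‖auxP lam (-(r : ℂ))‖ - r ^ (1 / κ) * A| ≤ ε * r ^ (1 / κ) := by
  have hκ0 : 0 < κ := by linarith
  have hsin : 0 < Real.sin (Real.pi / κ) := by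
    apply Real.sin_pos_of_pos_of_lt_pi (by positivity)
    rw [div_lt_iff₀ hκ0]; nlinarith [Real.pi_pos]
  refine ⟨Real.pi / Real.sin (Real.pi / κ) * (c ^ (1 / κ))⁻¹, by positivity, fun ε hε => ?_⟩
  obtain ⟨R, hR, h⟩ := aux_asymp hκ hc hpos hasym Real.pi_pos
    (by linarith [Real.pi_pos] : Real.pi < 2 * Real.pi) hε
  refine ⟨R, hR, fun r hr => ?_⟩
  have hr0 : 0 < r := hR.trans_le hr
  have hn : ‖-(r : ℂ)‖ = r := by rw [norm_neg, Complex.norm_real, Real.norm_of_nonneg hr0.le]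
  have h1 := h (-(r : ℂ)) (by rw [hn]; exact hr) (aux_branchArg_neg hr0).ge
    (aux_branchArg_neg hr0).le
  rw [hn, aux_branchArg_neg hr0, sub_self, aux_F_zero hκ hc, Complex.ofReal_re] at h1
  exact h1


/-- Exponential form of the paper's Proposition 3.2: for `λ_n = c n^κ (1+o(1))`, `κ > 1`,
`c > 0`, the product `P(z) = ∏_{n≥1} (1 − z/λ_n)` converges locally uniformly to an entire
function; uniformly in closed sectors `0 < θ₁ ≤ arg z ≤ θ₂ < 2π` one has
`ln|P(z)| = Re(−(2πi/((1 − e^{2πi/κ}) c^{1/κ})) z^{1/κ}) + o(|z|^{1/κ})`, and `P` is an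
entire function of order `1/κ`. -/
theorem characteristic_function_product_asymptotics
    (κ c : ℝ) (hκ : 1 < κ) (hc : 0 < c)
    (lam : ℕ → ℝ) (hpos : ∀ n, 1 ≤ n → 0 < lam n)
    (hasym : Tendsto (fun n : ℕ => lam n / (c * (n : ℝ) ^ κ)) atTop (nhds 1)) :
    ∃ P : ℂ → ℂ,
      TendstoLocallyUniformly
        (fun N : ℕ => fun z : ℂ => ∏ n ∈ Finset.range N, (1 - z / (lam (n + 1) : ℂ)))
        P atTop ∧
      Differentiable ℂ P ∧
      (∀ θ₁ θ₂ : ℝ, 0 < θ₁ → θ₁ ≤ θ₂ → θ₂ < 2 * Real.pi →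
        ∀ ε > 0, ∃ R > 0, ∀ z : ℂ, R ≤ ‖z‖ → θ₁ ≤ branchArg z → branchArg z ≤ θ₂ →
          |Real.log ‖P z‖ -
              (-((((2 * Real.pi : ℝ) : ℂ) * Complex.I) /
                  ((1 - Complex.exp (((2 * Real.pi : ℝ) : ℂ) * Complex.I / (κ : ℂ))) *
                    ((c ^ (1 / κ) : ℝ) : ℂ))) * branchCpow z (1 / κ)).re|
            ≤ ε * ‖z‖ ^ (1 / κ)) ∧
      (∀ ε > 0, ∃ C > 0, ∀ z : ℂ, ‖P z‖ ≤ C * Real.exp (‖z‖ ^ (1 / κ + ε))) ∧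
      (∀ ε > 0, ε < 1 / κ → ¬ ∃ C > 0, ∀ z : ℂ, ‖P z‖ ≤ C * Real.exp (‖z‖ ^ (1 / κ - ε))) := by
  obtain ⟨B, hB, hlow⟩ := aux_lam_lower hc hasym
  have hP := aux_P_tendsto hκ hpos hlow
  obtain ⟨A, hA, hneg⟩ := aux_neg hκ hc hpos hasym
  have hκ0 : 0 < κ := by linarith
  have hρ : 0 < 1 / κ := by positivity
  refine ⟨auxP lam, hP, ?_, ?_, ?_, ?_⟩
  · rw [← differentiableOn_univ]
    refine (hP.tendstoLocallyUniformlyOn (s := univ)).differentiableOn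
      (Eventually.of_forall fun N => ?_) isOpen_univ
    fun_prop
  · intro θ₁ θ₂ h1 _ h2 ε hε
    obtain ⟨R, hR, h⟩ := aux_asymp hκ hc hpos hasym h1 h2 hε
    refine ⟨R, hR, fun z hz hz1 hz2 => ?_⟩
    rw [aux_main_term hκ hc (hR.trans_le hz) rfl (abs_lt.2 ⟨by linarith, by linarith⟩),
      Complex.re_ofReal_mul]
    exact h z hz hz1 hz2
  · intro ε hε
    obtain ⟨R, hR, h⟩ := hneg 1 one_pos
    obtain ⟨R', hR'⟩ := ((tendsto_rpow_atTop hε).eventually_ge_atTop (A + 1)).exists_forall_of_atTop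
    set R₁ := max R R' with hR₁
    have hR₁0 : 0 < R₁ := hR.trans_le (le_max_left _ _)
    refine ⟨Real.exp (R₁ ^ (1 / κ + ε)), Real.exp_pos _, fun z => ?_⟩
    set r := max ‖z‖ R₁ with hr
    have hr0 : 0 < r := hR₁0.trans_le (le_max_right _ _)
    have h1 : ‖auxP lam z‖ ≤ ‖auxP lam (-(r : ℂ))‖ := aux_P_mono hpos hP (le_max_left _ _)
    have h2 := (abs_le.1 (h r ((le_max_left _ _).trans (le_max_right _ _)))).2
    have h3 : A + 1 ≤ r ^ ε := hR' r ((le_max_right _ _).trans (le_max_right _ _))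
    have h4 : Real.log ‖auxP lam (-(r : ℂ))‖ ≤ r ^ (1 / κ + ε) := by
      rw [Real.rpow_add hr0]
      have : r ^ (1 / κ) * (A + 1) ≤ r ^ (1 / κ) * r ^ ε :=
        mul_le_mul_of_nonneg_left h3 (by positivity)
      linarith
    have h5 : r ^ (1 / κ + ε) ≤ R₁ ^ (1 / κ + ε) + ‖z‖ ^ (1 / κ + ε) := by
      have e1 : 0 ≤ R₁ ^ (1 / κ + ε) := by positivity
      have e2 : 0 ≤ ‖z‖ ^ (1 / κ + ε) := by positivity
      rcases max_choice ‖z‖ R₁ with h | h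
      · rw [hr, h]; linarith
      · rw [hr, h]; linarith
    rw [← Real.exp_add]
    exact (h1.trans (Real.le_exp_log _)).trans (Real.exp_le_exp.2 (h4.trans h5))
  · rintro ε hε hε' ⟨C, hC, hbd⟩
    obtain ⟨R, hR, h⟩ := hneg (A / 2) (by positivity)
    have hlim : Tendsto (fun r : ℝ => Real.log C * r ^ (-(1 / κ)) + r ^ (-ε)) atTop (𝓝 0) := by
      have := ((tendsto_rpow_neg_atTop hρ).const_mul (Real.log C)).add
        (tendsto_rpow_neg_atTop hε)
      simpa using this
    have hge : A / 2 ≤ 0 := by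
      refine ge_of_tendsto hlim ?_
      filter_upwards [eventually_ge_atTop R] with r hr
      have hr0 : 0 < r := hR.trans_le hr
      have hrp : 0 < r ^ (1 / κ) := by positivity
      have h1 := (abs_le.1 (h r hr)).1
      have h2 : A / 2 * r ^ (1 / κ) ≤ Real.log ‖auxP lam (-(r : ℂ))‖ := by linarith
      have hne : ‖auxP lam (-(r : ℂ))‖ ≠ 0 := by
        intro h0
        rw [h0, Real.log_zero] at h2
        have : 0 < A / 2 * r ^ (1 / κ) := by positivity
        linarith
      have h3 := hbd (-(r : ℂ))
      rw [norm_neg (r : ℂ), Complex.norm_real, Real.norm_of_nonneg hr0.le] at h3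
      have h4 := Real.log_le_log (lt_of_le_of_ne (norm_nonneg _) hne.symm) h3
      rw [Real.log_mul hC.ne' (Real.exp_ne_zero _), Real.log_exp] at h4
      have h5 : r ^ (1 / κ - ε) = r ^ (-ε) * r ^ (1 / κ) := by
        rw [← Real.rpow_add hr0]; congr 1; ring
      have h6 : Real.log C = Real.log C * r ^ (-(1 / κ)) * r ^ (1 / κ) := by
        rw [mul_assoc, ← Real.rpow_add hr0]; simp
      rw [h5, h6, ← add_mul] at h4
      exact le_of_mul_le_mul_right (h2.trans h4) hrp
    linarith
end
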